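/- arXiv:1810.03675 — 3 statements merged into one kernel-verified Lean document; each statement's English description precedes it below -/
import Mathlib

section
/- (Pohst) If n ≤ 11 and z₁, …, z_n are non-zero real numbers arranged so that |z₁| ≤ |z₂| ≤ ⋯ ≤ |z_n|, then ∏_{1 ≤ i < j ≤ n} |1 − z_i/z_j|² ≤ 4^⌊n/2⌋, where ⌊n/2⌋ = (n−1)/2 if n is odd and ⌊n/2⌋ = n/2 if n is even. -/
open Finset

noncomputable def phF (x u : ℝ) : ℝ := |1 - u| * |1 + x * u|

noncomputable def sgF (u : ℝ) : ℤ := if 0 < u then 1 else -1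

noncomputable def ssF (l : List ℝ) : ℤ := (l.map sgF).sum

noncomputable def PPF : List ℝ → ℝ
  | [] => 1
  | z :: l => (l.map (fun w => |1 - z / w|)).prod * PPF l

lemma phF_nonneg (x u : ℝ) : 0 ≤ phF x u := by unfold phF; positivity

lemma phF_eq {x u : ℝ} (hx : 0 ≤ x) (hx1 : x ≤ 1) (hu : |u| ≤ 1) :
    phF x u = (1 - u) * (1 + x * u) := by
  have h := abs_le.1 hu
  unfold phF
  rw [abs_of_nonneg (by linarith), abs_of_nonneg (by nlinarith)]

lemma phF_le_one {x v : ℝ} (hx : 0 ≤ x) (hx1 : x ≤ 1) (hv : 0 ≤ v) (hv1 : v ≤ 1) :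
    phF x v ≤ 1 := by
  rw [phF_eq hx hx1 (by rw [abs_of_nonneg hv]; exact hv1)]
  nlinarith [mul_nonneg hx hv, mul_nonneg hx (mul_nonneg hv hv), mul_nonneg (sub_nonneg.2 hx1) hv]

lemma phF_anti {x u v : ℝ} (hx : 0 ≤ x) (hx1 : x ≤ 1) (hu : 0 ≤ u) (huv : u ≤ v) (hv1 : v ≤ 1) :
    phF x v ≤ phF x u := by
  rw [phF_eq hx hx1 (by rw [abs_of_nonneg (by linarith)]; exact hv1),
    phF_eq hx hx1 (by rw [abs_of_nonneg hu]; linarith)]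
  have h : (1 - u) * (1 + x * u) - (1 - v) * (1 + x * v)
      = (v - u) * ((1 - x) + x * (u + v)) := by ring
  have : 0 ≤ (v - u) * ((1 - x) + x * (u + v)) :=
    mul_nonneg (by linarith) (add_nonneg (by linarith) (mul_nonneg hx (by linarith)))
  linarith

lemma phF_pair {x u v : ℝ} (hx : 0 ≤ x) (hx1 : x ≤ 1) (hu : u ≤ 0) (huv : |u| ≤ v) (hv1 : v ≤ 1) :
    phF x v * phF x u ≤ 1 := by
  have h0 := abs_nonneg u
  refine (mul_le_mul_of_nonneg_right (phF_anti hx hx1 h0 huv hv1) (phF_nonneg _ _)).trans ?_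
  rw [phF_eq hx hx1 (by rw [abs_abs]; linarith), phF_eq hx hx1 (by linarith)]
  rw [abs_of_nonpos hu] at *
  have h1 : 0 ≤ u ^ 2 := sq_nonneg u
  have h2 : u ^ 2 ≤ 1 := by nlinarith
  have h3 : 0 ≤ x ^ 2 * u ^ 2 := by positivity
  have h4 : x ^ 2 * u ^ 2 ≤ 1 := by nlinarith [mul_nonneg hx (sub_nonneg.2 hx1)]
  have : (1 - -u) * (1 + x * -u) * ((1 - u) * (1 + x * u)) = (1 - u ^ 2) * (1 - x ^ 2 * u ^ 2) := by
    ring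
  rw [this]
  nlinarith

lemma phF_tri {x u : ℝ} (hx : 0 ≤ x) (hx1 : x ≤ 1) (hu : u ≤ 0) (huv : |u| ≤ 1) :
    (1 + x) / 2 * phF x u ≤ 1 := by
  rw [phF_eq hx hx1 huv]
  rw [abs_of_nonpos hu] at *
  have h1 : 0 ≤ x * -u := mul_nonneg hx (by linarith)
  have h2 : x * -u ≤ 1 := by nlinarith
  have h3 : (1 + x) * (1 - u) ≤ 2 * (1 + x * -u) := by nlinarith
  nlinarith [mul_le_mul_of_nonneg_right h3 (show 0 ≤ 1 + x * u by linarith)]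

lemma prod_phF_nonneg (x : ℝ) (l : List ℝ) : 0 ≤ (l.map (phF x)).prod := by
  apply List.prod_nonneg
  intro a ha
  obtain ⟨u, _, rfl⟩ := List.mem_map.1 ha
  exact phF_nonneg _ _

lemma ssF_cons (u : ℝ) (l : List ℝ) : ssF (u :: l) = sgF u + ssF l := by simp [ssF]

lemma ssF_append (k l : List ℝ) : ssF (k ++ l) = ssF k + ssF l := by simp [ssF]

lemma core {x : ℝ} (hx : 0 ≤ x) (hx1 : x ≤ 1) : ∀ (l : List ℝ) (v : ℝ) (d : ℕ), 0 ≤ v → v ≤ 1 →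
    (∀ u ∈ l, |u| ≤ v) → l.Pairwise (fun a b => |b| ≤ |a|) →
    (∀ p, p <+: l → 0 ≤ (d : ℤ) + ssF p) → phF x v ^ d * (l.map (phF x)).prod ≤ 1 := by
  intro l
  induction l with
  | nil =>
    intro v d h0 h1 _ _ _
    simpa using pow_le_one₀ (phF_nonneg _ _) (phF_le_one hx hx1 h0 h1)
  | cons u t ih =>
    intro v d h0 h1 hl hs hp
    have huv := hl u (by simp)
    rw [List.pairwise_cons] at hs
    have hn := prod_phF_nonneg x t
    have hp' : ∀ p, p <+: t → 0 ≤ (d : ℤ) + (sgF u + ssF p) := by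
      intro p hpt
      rw [← ssF_cons]
      exact hp _ ((List.prefix_cons_inj u).2 hpt)
    rw [List.map_cons, List.prod_cons]
    by_cases hu : 0 < u
    · rw [abs_of_pos hu] at huv
      have := ih u (d + 1) hu.le (huv.trans h1)
        (fun w hw => by have := hs.1 w hw; rwa [abs_of_pos hu] at this) hs.2
        (fun p hpt => by have := hp' p hpt; simp only [sgF, if_pos hu] at this; push_cast; linarith)
      refine le_trans ?_ this
      rw [pow_succ, mul_assoc]
      exact mul_le_mul_of_nonneg_right
        (pow_le_pow_left₀ (phF_nonneg _ _) (phF_anti hx hx1 hu.le huv h1) d)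
        (mul_nonneg (phF_nonneg _ _) hn)
    · have hs1 : sgF u = -1 := by simp [sgF, hu]
      have hd := hp' [] (by simp)
      rw [hs1] at hd hp'
      obtain ⟨e, rfl⟩ : ∃ e, d = e + 1 := ⟨d - 1, by simp [ssF] at hd; omega⟩
      have := ih v e h0 h1 (fun w hw => hl w (by simp [hw])) hs.2
        (fun p hpt => by have := hp' p hpt; push_cast at this; linarith)
      have h2 := phF_pair hx hx1 (not_lt.1 hu) huv h1
      have h3 : 0 ≤ phF x v ^ e * (t.map (phF x)).prod :=
        mul_nonneg (pow_nonneg (phF_nonneg _ _) _) hn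
      calc _ = (phF x v * phF x u) * (phF x v ^ e * (t.map (phF x)).prod) := by ring
        _ ≤ 1 * 1 := mul_le_mul h2 this h3 (by norm_num)
        _ = 1 := by ring

lemma core2 {x : ℝ} (hx : 0 ≤ x) (hx1 : x ≤ 1) : ∀ (l : List ℝ) (v : ℝ) (d : ℕ), 0 ≤ v → v ≤ 1 →
    (∀ u ∈ l, |u| ≤ v) → l.Pairwise (fun a b => |b| ≤ |a|) →
    (∀ p, p <+: l → 0 ≤ (d : ℤ) + 1 + ssF p) →
    (1 + x) / 2 * (phF x v ^ d * (l.map (phF x)).prod) ≤ 1 := by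
  intro l
  induction l with
  | nil =>
    intro v d h0 h1 _ _ _
    have h := pow_le_one₀ (n := d) (phF_nonneg _ _) (phF_le_one hx hx1 h0 h1)
    have h' := pow_nonneg (phF_nonneg x v) d
    simp only [List.map_nil, List.prod_nil, mul_one]
    nlinarith
  | cons u t ih =>
    intro v d h0 h1 hl hs hp
    have huv := hl u (by simp)
    have hs0 := hs
    rw [List.pairwise_cons] at hs
    have hn := prod_phF_nonneg x t
    have hp' : ∀ p, p <+: t → 0 ≤ (d : ℤ) + 1 + (sgF u + ssF p) := by
      intro p hpt
      rw [← ssF_cons]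
      exact hp _ ((List.prefix_cons_inj u).2 hpt)
    rw [List.map_cons, List.prod_cons]
    by_cases hu : 0 < u
    · rw [abs_of_pos hu] at huv
      have := ih u (d + 1) hu.le (huv.trans h1)
        (fun w hw => by have := hs.1 w hw; rwa [abs_of_pos hu] at this) hs.2
        (fun p hpt => by have := hp' p hpt; simp only [sgF, if_pos hu] at this; push_cast; linarith)
      refine le_trans ?_ this
      rw [pow_succ, mul_assoc]
      exact mul_le_mul_of_nonneg_left (mul_le_mul_of_nonneg_right
        (pow_le_pow_left₀ (phF_nonneg _ _) (phF_anti hx hx1 hu.le huv h1) d)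
        (mul_nonneg (phF_nonneg _ _) hn)) (by linarith)
    · have hs1 : sgF u = -1 := by simp [sgF, hu]
      rw [hs1] at hp'
      rcases d with _ | e
      · have := core hx hx1 t v 0 h0 h1 (fun w hw => hl w (by simp [hw])) hs.2
          (fun p hpt => by have := hp' p hpt; push_cast at this ⊢; linarith)
        have h2 := phF_tri hx hx1 (not_lt.1 hu) (huv.trans h1)
        simp only [pow_zero, one_mul] at this ⊢
        calc _ = ((1 + x) / 2 * phF x u) * ((t.map (phF x)).prod) := by ring
          _ ≤ 1 * 1 := mul_le_mul h2 this hn (by norm_num)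
          _ = 1 := by ring
      · have := ih v e h0 h1 (fun w hw => hl w (by simp [hw])) hs.2
          (fun p hpt => by have := hp' p hpt; push_cast at this; linarith)
        have h2 := phF_pair hx hx1 (not_lt.1 hu) huv h1
        have h3 : 0 ≤ (1 + x) / 2 * (phF x v ^ e * (t.map (phF x)).prod) :=
          mul_nonneg (by linarith) (mul_nonneg (pow_nonneg (phF_nonneg _ _) _) hn)
        calc _ = (phF x v * phF x u) * ((1 + x) / 2 * (phF x v ^ e * (t.map (phF x)).prod)) := by ring
          _ ≤ 1 * 1 := mul_le_mul h2 this h3 (by norm_num)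
          _ = 1 := by ring

lemma PPF_remove (L : List ℝ) (a : ℝ) (R : List ℝ) : PPF (L ++ a :: R) =
    PPF (L ++ R) * (L.map (fun z => |1 - z / a|)).prod * (R.map (fun w => |1 - a / w|)).prod := by
  induction L with
  | nil => simp [PPF, mul_comm]
  | cons z L ih =>
    simp only [List.cons_append, PPF, ih, List.map_append, List.map_cons, List.prod_append,
      List.prod_cons]
    ring

lemma PPF_nonneg (l : List ℝ) : 0 ≤ PPF l := by
  induction l with
  | nil => simp [PPF]
  | cons z l ih =>
    refine mul_nonneg (List.prod_nonneg ?_) ih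
    intro a ha
    obtain ⟨u, _, rfl⟩ := List.mem_map.1 ha
    positivity

lemma PPF_neg (l : List ℝ) : PPF (l.map (fun z => -z)) = PPF l := by
  induction l with
  | nil => simp [PPF]
  | cons z l ih =>
    simp only [List.map_cons, PPF, ih, List.map_map]
    congr 3
    funext w
    simp [neg_div_neg_eq]

lemma decomp (l : List ℝ) (hl : ∀ z ∈ l, z ≠ 0) : (∀ p, p <+: l → ssF p ≤ 0) ∨
    ∃ L a R, l = L ++ a :: R ∧ 0 < a ∧ (∀ s, s <:+ L → 0 ≤ ssF s) ∧ (∀ p, p <+: R → ssF p ≤ 0) ∧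
      (∀ p, p <+: l → ssF p ≤ ssF L + 1) := by
  induction l with
  | nil => left; intro p hp; simp at hp; subst hp; simp [ssF]
  | cons z t ih =>
    rcases ih (fun w hw => hl w (by simp [hw])) with h | ⟨L, a, R, rfl, ha, hL, hR, hM⟩
    · by_cases hz : 0 < z
      · right
        refine ⟨[], z, t, rfl, hz, ?_, h, ?_⟩
        · intro s hs; simp at hs; subst hs; simp [ssF]
        · intro p hp
          rcases List.prefix_cons_iff.1 hp with rfl | ⟨q, rfl, hq⟩
          · simp [ssF]
          · rw [ssF_cons]; have := h q hq; simp [sgF, hz, ssF] at *; linarith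
      · left
        intro p hp
        rcases List.prefix_cons_iff.1 hp with rfl | ⟨q, rfl, hq⟩
        · simp [ssF]
        · rw [ssF_cons]; have := h q hq; simp [sgF, hz] at *; linarith
    · by_cases hc : 0 ≤ ssF (z :: L)
      · right
        refine ⟨z :: L, a, R, rfl, ha, ?_, hR, ?_⟩
        · intro s hs
          rcases List.suffix_cons_iff.1 hs with rfl | hs
          · exact hc
          · exact hL s hs
        · intro p hp
          rcases List.prefix_cons_iff.1 hp with rfl | ⟨q, rfl, hq⟩
          · simp [ssF] at *; linarith
          · have := hM q hq
            rw [ssF_cons, ssF_cons]; linarith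
      · left
        intro p hp
        rcases List.prefix_cons_iff.1 hp with rfl | ⟨q, rfl, hq⟩
        · simp [ssF]
        · have := hM q hq
          rw [ssF_cons] at *; omega

lemma sgF_div_pos {z a : ℝ} (ha : 0 < a) : sgF (z / a) = sgF z := by
  unfold sgF; simp [ha]

lemma sgF_div_neg {w b : ℝ} (hb : b < 0) (hw : w ≠ 0) : sgF (b / w) = - sgF w := by
  unfold sgF
  rcases lt_or_gt_of_ne hw with h | h
  · rw [if_pos (div_pos_of_neg_of_neg hb h), if_neg (by linarith)]; rfl
  · rw [if_neg (not_lt.2 (div_neg_of_neg_of_pos hb h).le), if_pos h]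

lemma left_bound {x : ℝ} (hx : 0 ≤ x) (hx1 : x ≤ 1) (L : List ℝ) (a : ℝ) (ha : 0 < a)
    (hs : L.Pairwise (fun p q => |p| ≤ |q|)) (hLa : ∀ z ∈ L, |z| ≤ |a|)
    (hL : ∀ s, s <:+ L → 0 ≤ ssF s) : (L.map (fun z => phF x (z / a))).prod ≤ 1 := by
  have key := core hx hx1 (L.reverse.map (fun z => z / a)) 1 0 zero_le_one le_rfl ?_ ?_ ?_
  · simp only [pow_zero, one_mul, List.map_map] at key
    rw [List.map_reverse, List.prod_reverse] at key
    exact key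
  · intro u hu
    simp only [List.mem_map, List.mem_reverse] at hu
    obtain ⟨z, hz, rfl⟩ := hu
    rw [abs_div]
    exact div_le_one_of_le₀ (hLa z hz) (abs_nonneg _)
  · rw [List.pairwise_map, List.pairwise_reverse]
    refine hs.imp ?_
    intro p q h
    rw [abs_div, abs_div]
    gcongr
  · intro p hp
    obtain ⟨q, hq, rfl⟩ := List.prefix_map_iff.1 hp
    have h1 : q.reverse <:+ L := by
      rw [← List.reverse_prefix]; simpa using hq
    have := hL _ h1
    have h2 : ssF (q.map (fun z => z / a)) = ssF q.reverse := by
      simp [ssF, Function.comp_def, sgF_div_pos ha]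
    rw [h2]; simpa using this

lemma right_bound {x : ℝ} (hx : 0 ≤ x) (hx1 : x ≤ 1) (R : List ℝ) (b : ℝ) (hb : b < 0)
    (h0 : ∀ z ∈ R, z ≠ 0)
    (hs : R.Pairwise (fun p q => |p| ≤ |q|)) (hR : ∀ z ∈ R, |b| ≤ |z|)
    (hp : ∀ s, s <+: R → ssF s ≤ 1) : (1 + x) * (R.map (fun w => phF x (b / w))).prod ≤ 2 := by
  have key := core2 hx hx1 (R.map (fun w => b / w)) 1 0 zero_le_one le_rfl ?_ ?_ ?_
  · simp only [pow_zero, one_mul, List.map_map] at key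
    have : (R.map (fun w => phF x (b / w))).prod = (R.map (phF x ∘ fun w => b / w)).prod := rfl
    rw [this]; linarith
  · intro u hu
    simp only [List.mem_map] at hu
    obtain ⟨z, hz, rfl⟩ := hu
    rw [abs_div]
    exact div_le_one_of_le₀ (hR z hz) (abs_nonneg _)
  · rw [List.pairwise_map]
    refine hs.imp_of_mem ?_
    intro p q hp hq h
    rw [abs_div, abs_div]
    have := abs_pos.2 (h0 p hp)
    gcongr
  · intro p hpp
    obtain ⟨q, hq, rfl⟩ := List.prefix_map_iff.1 hpp
    have h1 := hp q hq
    have h2 : ssF (q.map (fun w => b / w)) = - ssF q := by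
      have hq0 : ∀ z ∈ q, z ≠ 0 := fun z hz => h0 z (hq.subset hz)
      clear h1 hq hpp
      induction q with
      | nil => simp [ssF]
      | cons w q ih =>
        rw [List.map_cons, ssF_cons, ssF_cons, ih (fun z hz => hq0 z (by simp [hz])),
          sgF_div_neg hb (hq0 w (by simp))]
        ring
    rw [h2]; push_cast; linarith

lemma PPF_step (l : List ℝ) (hl : ∀ z ∈ l, z ≠ 0) (hs : l.Pairwise (fun p q => |p| ≤ |q|))
    (hne : ¬ (∀ p, p <+: l → ssF p ≤ 0)) :
    ∃ l' : List ℝ, l'.Sublist l ∧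
      ((l.length = l'.length + 1 ∧ PPF l ≤ PPF l') ∨
       (l.length = l'.length + 2 ∧ PPF l ≤ 2 * PPF l')) := by
  rcases decomp l hl with h | ⟨L, a, R, rfl, ha, hL, hR, -⟩
  · exact absurd h hne
  rw [List.pairwise_append] at hs
  obtain ⟨hsL, hsR, hLR⟩ := hs
  rcases R with _ | ⟨b, R⟩
  · refine ⟨L, by simp, Or.inl ⟨by simp, ?_⟩⟩
    have := left_bound le_rfl zero_le_one L a ha hsL (fun z hz => hLR z hz a (by simp)) hL
    rw [PPF_remove]
    simp only [List.append_nil, List.map_nil, List.prod_nil, mul_one]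
    have h2 : (L.map (fun z => |1 - z / a|)).prod ≤ 1 := by simpa [phF] using this
    nlinarith [PPF_nonneg L]
  · have hb0 : b ≠ 0 := hl b (by simp)
    have hb : b < 0 := by
      have := hR [b] (by simp)
      by_contra hc
      have : 0 < b := lt_of_le_of_ne (not_lt.1 hc) hb0.symm
      simp [ssF, sgF, this] at *
    rw [List.pairwise_cons] at hsR
    obtain ⟨haR, hsR⟩ := hsR
    rw [List.pairwise_cons] at hsR
    have hab := haR b (by simp)
    set x := - a / b with hxd
    have hx : 0 ≤ x := by rw [hxd, neg_div, ← div_neg]; exact div_nonneg ha.le (by linarith)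
    have hx1 : x ≤ 1 := by
      rw [abs_of_pos ha, abs_of_neg hb] at hab
      rw [hxd, neg_div, ← div_neg]; exact div_le_one_of_le₀ hab (by linarith)
    have e1 := left_bound hx hx1 L a ha hsL (fun z hz => hLR z hz a (by simp)) hL
    have e2 := right_bound hx hx1 R b hb (fun z hz => hl z (by simp [hz])) hsR.2 hsR.1 (by
      intro s hs
      have := hR (b :: s) ((List.prefix_cons_inj b).2 hs)
      rw [ssF_cons] at this
      have hsb : sgF b = -1 := by simp [sgF, hb.le]
      omega)
    refine ⟨L ++ R, ?_, Or.inr ⟨by simp; ring, ?_⟩⟩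
    · exact List.Sublist.append (List.Sublist.refl _)
        (((List.Sublist.refl R).cons b).cons a)
    · have f1 : (L.map (fun z => phF x (z / a))).prod =
          (L.map (fun z => |1 - z / a|)).prod * (L.map (fun z => |1 - z / b|)).prod := by
        rw [← List.prod_map_mul]
        congr 1
        apply List.map_congr_left
        intro z hz
        have : 1 + x * (z / a) = 1 - z / b := by rw [hxd]; field_simp; ring
        rw [phF, this]
      have f2 : (R.map (fun w => phF x (b / w))).prod =
          (R.map (fun z => |1 - b / z|)).prod * (R.map (fun z => |1 - a / z|)).prod := by
        rw [← List.prod_map_mul]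
        congr 1
        apply List.map_congr_left
        intro z hz
        have hz0 : z ≠ 0 := hl z (by simp [hz])
        have : 1 + x * (b / z) = 1 - a / z := by rw [hxd]; field_simp; ring
        rw [phF, this]
      have f3 : |1 - a / b| = 1 + x := by
        rw [hxd] at hx ⊢
        have : 1 - a / b = 1 + -a / b := by ring
        rw [this, abs_of_nonneg (by linarith)]
      have g1 : 0 ≤ (L.map (fun z => phF x (z / a))).prod := by
        have := prod_phF_nonneg x (L.map (fun z => z / a))
        rwa [List.map_map] at this
      have g2 : 0 ≤ (R.map (fun w => phF x (b / w))).prod := by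
        have := prod_phF_nonneg x (R.map (fun w => b / w))
        rwa [List.map_map] at this
      rw [PPF_remove, PPF_remove, List.map_cons, List.prod_cons, f3]
      have g3 := PPF_nonneg (L ++ R)
      calc _ = PPF (L ++ R) * ((L.map (fun z => phF x (z / a))).prod *
            ((1 + x) * (R.map (fun w => phF x (b / w))).prod)) := by rw [f1, f2]; ring
        _ ≤ PPF (L ++ R) * (1 * 2) := by
            apply mul_le_mul_of_nonneg_left _ g3
            exact mul_le_mul e1 e2 (mul_nonneg (by linarith) g2) zero_le_one
        _ = _ := by ring

lemma PPF_bound : ∀ (n : ℕ) (l : List ℝ), l.length = n → (∀ z ∈ l, z ≠ 0) →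
    l.Pairwise (fun p q => |p| ≤ |q|) → PPF l ≤ 2 ^ (n / 2) := by
  intro n
  induction n using Nat.strong_induction_on with
  | _ n ih =>
    have main : ∀ l : List ℝ, l.length = n → (∀ z ∈ l, z ≠ 0) →
        l.Pairwise (fun p q => |p| ≤ |q|) → ¬ (∀ p, p <+: l → ssF p ≤ 0) →
        PPF l ≤ 2 ^ (n / 2) := by
      intro l hn hl hs hne
      obtain ⟨l', hsub, h⟩ := PPF_step l hl hs hne
      have hI : l'.length < n → PPF l' ≤ 2 ^ (l'.length / 2) := fun hlt =>
        ih _ hlt l' rfl (fun z hz => hl z (hsub.subset hz)) (hs.sublist hsub)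
      rcases h with ⟨h1, h2⟩ | ⟨h1, h2⟩
      · refine h2.trans ((hI (by omega)).trans ?_)
        exact pow_le_pow_right₀ (by norm_num) (by omega)
      · have h3 := hI (by omega)
        have h4 : n / 2 = l'.length / 2 + 1 := by omega
        rw [h4, pow_succ]; linarith
    intro l hn hl hs
    rcases l with _ | ⟨z, t⟩
    · simp at hn; subst hn; simp [PPF]
    · rcases lt_or_gt_of_ne (hl z (by simp)) with hz | hz
      · rw [← PPF_neg]
        apply main
        · simpa using hn
        · intro w hw
          obtain ⟨y, hy, rfl⟩ := List.mem_map.1 hw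
          exact neg_ne_zero.2 (hl y hy)
        · rw [List.pairwise_map]; simpa only [abs_neg] using hs
        · intro h
          have := h [-z] (by simp)
          simp [ssF, sgF, hz] at this
      · apply main _ hn hl hs
        intro h
        have := h [z] (by simp)
        simp [ssF, sgF, hz] at this

lemma PPF_ofFn : ∀ (n : ℕ) (z : Fin n → ℝ), PPF (List.ofFn z) =
    ∏ i, ∏ j, if i < j then |1 - z i / z j| else 1 := by
  intro n
  induction n with
  | zero => intro z; simp [PPF]
  | succ n ih =>
    intro z
    rw [List.ofFn_succ, PPF, ih, Fin.prod_univ_succ, List.map_ofFn, List.prod_ofFn]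
    congr 1
    · rw [Fin.prod_univ_succ]; simp
    · apply Finset.prod_congr rfl
      intro i _
      rw [Fin.prod_univ_succ]; simp

/-- **Pohst's inequality**: if `n ≤ 11` and `z₁,…,zₙ` are nonzero real numbers
with `|z₁| ≤ ⋯ ≤ |zₙ|`, then `∏_{i<j} |1 − zᵢ/zⱼ|² ≤ 4^⌊n/2⌋`. -/
theorem pohst_prod_bound (n : ℕ) (hn : n ≤ 11) (z : Fin n → ℝ)
    (hz : ∀ i, z i ≠ 0)
    (hmono : ∀ i j : Fin n, i ≤ j → |z i| ≤ |z j|) :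
    (∏ p ∈ Finset.univ.filter (fun p : Fin n × Fin n => p.1 < p.2),
      |1 - z p.1 / z p.2| ^ 2) ≤ (4 : ℝ) ^ (n / 2) := by
  have h := PPF_bound n (List.ofFn z) (by simp)
    (by intro w hw; obtain ⟨i, rfl⟩ := (List.mem_ofFn' _ _).1 hw; exact hz i)
    (by rw [List.pairwise_ofFn]; intro i j hij; exact hmono i j hij.le)
  have h0 := PPF_nonneg (List.ofFn z)
  rw [PPF_ofFn] at h h0
  rw [Finset.prod_pow, Finset.prod_filter, Fintype.prod_prod_type]
  have h4 : (4 : ℝ) ^ (n / 2) = (2 ^ (n / 2)) ^ 2 := by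
    rw [← pow_mul, mul_comm, pow_mul]; norm_num
  rw [h4]
  exact pow_le_pow_left₀ h0 h 2
end

section
/- Let r₁, …, r₅ be non-zero real numbers with 0 < |r₁| ≤ |r₂| ≤ ⋯ ≤ |r₅| and r₁ > 0. If the number of indices i with r_i < 0 is exactly 1 or exactly 4, then ∏_{1 ≤ i < j ≤ 5} |1 − r_i/r_j|² ≤ 4. -/
open Finset

theorem aux_m {A B : ℝ} (hA : 0 ≤ A ∧ A ≤ 2) (hB : 0 ≤ B ∧ B ≤ 1) :
    0 ≤ A * B ∧ A * B ≤ 2 :=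
  ⟨mul_nonneg hA.1 hB.1, by nlinarith [hA.1, hA.2, hB.1, hB.2]⟩

theorem aux_two {u v : ℝ} (hu : 0 ≤ u ∧ u ≤ 1) (hv : 0 ≤ v ∧ v ≤ 1) :
    0 ≤ (1 + u) * (1 + v) * (1 - u * v) ∧ (1 + u) * (1 + v) * (1 - u * v) ≤ 2 := by
  obtain ⟨hu0, hu1⟩ := hu
  obtain ⟨hv0, hv1⟩ := hv
  have hp : 0 ≤ 1 - u * v := by nlinarith
  refine ⟨by positivity, ?_⟩
  have := mul_nonneg (mul_nonneg hp (sub_nonneg.2 hu1)) (sub_nonneg.2 hv1)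
  nlinarith [sq_nonneg (u * v)]

theorem aux_one {u v : ℝ} (hu : 0 ≤ u ∧ u ≤ 1) (hv : 0 ≤ v ∧ v ≤ 1) :
    0 ≤ (1 - u) * (1 + u * v) ∧ (1 - u) * (1 + u * v) ≤ 1 := by
  obtain ⟨hu0, hu1⟩ := hu
  obtain ⟨hv0, hv1⟩ := hv
  have h0 : 0 ≤ u * v := mul_nonneg hu0 hv0
  have h1 : u * v ≤ u := by nlinarith
  have := sub_nonneg.2 hu1
  refine ⟨by positivity, ?_⟩
  nlinarith

theorem aux_p {u v : ℝ} (hu : 0 ≤ u ∧ u ≤ 1) (hv : 0 ≤ v ∧ v ≤ 1) : 0 ≤ u * v ∧ u * v ≤ 1 :=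
  ⟨mul_nonneg hu.1 hv.1, mul_le_one₀ hu.2 hv.1 hv.2⟩

theorem aux_s {u : ℝ} (hu : 0 ≤ u ∧ u ≤ 1) : 0 ≤ 1 - u ∧ 1 - u ≤ 1 :=
  ⟨by linarith [hu.2], by linarith [hu.1]⟩

theorem aux_t {u : ℝ} (hu : 0 ≤ u ∧ u ≤ 1) : 0 ≤ 1 + u ∧ 1 + u ≤ 2 :=
  ⟨by linarith [hu.1], by linarith [hu.2]⟩

def QQ (x y z w : ℝ) : ℝ :=
  (1 - x) * (1 - x * y) * (1 - x * y * z) * (1 - x * y * z * w) * (1 - y) * (1 - y * z) *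
    (1 - y * z * w) * (1 - z) * (1 - z * w) * (1 - w)

section
variable {x y z w : ℝ} (hx : 0 ≤ x ∧ x ≤ 1) (hy : 0 ≤ y ∧ y ≤ 1) (hz : 0 ≤ z ∧ z ≤ 1)
  (hw : 0 ≤ w ∧ w ≤ 1)

theorem case1 (hx : 0 ≤ x ∧ x ≤ 1) (hy : 0 ≤ y ∧ y ≤ 1) (hz : 0 ≤ z ∧ z ≤ 1)
    (hw : 0 ≤ w ∧ w ≤ 1) : 0 ≤ QQ (-x) y z w ∧ QQ (-x) y z w ≤ 2 := by
  have h := aux_m (aux_m (aux_m (aux_m (aux_m (aux_m (aux_t hx) (aux_one hy hx))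
    (aux_one (aux_p hy hz) hx)) (aux_one (aux_p (aux_p hy hz) hw) hx)) (aux_s hz))
    (aux_s (aux_p hz hw))) (aux_s hw)
  convert h using 2 <;> (unfold QQ; ring)

theorem case2 (hx : 0 ≤ x ∧ x ≤ 1) (hy : 0 ≤ y ∧ y ≤ 1) (hz : 0 ≤ z ∧ z ≤ 1)
    (hw : 0 ≤ w ∧ w ≤ 1) : 0 ≤ QQ (-x) (-y) z w ∧ QQ (-x) (-y) z w ≤ 2 := by
  have h := aux_m (aux_m (aux_m (aux_m (aux_m (aux_two hx hy) (aux_one hz hy))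
    (aux_one (aux_p hz hw) hy)) (aux_s (aux_p (aux_p hx hy) hz)))
    (aux_s (aux_p (aux_p (aux_p hx hy) hz) hw))) (aux_s hw)
  convert h using 2 <;> (unfold QQ; ring)

theorem case3 (hx : 0 ≤ x ∧ x ≤ 1) (hy : 0 ≤ y ∧ y ≤ 1) (hz : 0 ≤ z ∧ z ≤ 1)
    (hw : 0 ≤ w ∧ w ≤ 1) : 0 ≤ QQ x (-y) (-z) w ∧ QQ x (-y) (-z) w ≤ 2 := by
  have h := aux_m (aux_m (aux_m (aux_m (aux_m (aux_two hy hz) (aux_one hx hy))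
    (aux_one hw hz)) (aux_s (aux_p (aux_p hx hy) hz)))
    (aux_s (aux_p (aux_p (aux_p hx hy) hz) hw))) (aux_s (aux_p (aux_p hy hz) hw))
  convert h using 2 <;> (unfold QQ; ring)

theorem case4 (hx : 0 ≤ x ∧ x ≤ 1) (hy : 0 ≤ y ∧ y ≤ 1) (hz : 0 ≤ z ∧ z ≤ 1)
    (hw : 0 ≤ w ∧ w ≤ 1) : 0 ≤ QQ x y (-z) (-w) ∧ QQ x y (-z) (-w) ≤ 2 := by
  have h := aux_m (aux_m (aux_m (aux_m (aux_m (aux_two hz hw) (aux_one hy hz))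
    (aux_one (aux_p hx hy) hz)) (aux_s hx))
    (aux_s (aux_p (aux_p (aux_p hx hy) hz) hw))) (aux_s (aux_p (aux_p hy hz) hw))
  convert h using 2 <;> (unfold QQ; ring)

theorem case5 (hx : 0 ≤ x ∧ x ≤ 1) (hy : 0 ≤ y ∧ y ≤ 1) (hz : 0 ≤ z ∧ z ≤ 1)
    (hw : 0 ≤ w ∧ w ≤ 1) : 0 ≤ QQ x y z (-w) ∧ QQ x y z (-w) ≤ 2 := by
  have h := aux_m (aux_m (aux_m (aux_m (aux_m (aux_m (aux_t hw) (aux_one hz hw))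
    (aux_one (aux_p hy hz) hw)) (aux_one (aux_p (aux_p hx hy) hz) hw)) (aux_s hx))
    (aux_s (aux_p hx hy))) (aux_s hy)
  convert h using 2 <;> (unfold QQ; ring)
end

theorem aux_pos {a b : ℝ} (h : |a| ≤ |b|) (hs : 0 ≤ a / b) : 0 ≤ a / b ∧ a / b ≤ 1 := by
  refine ⟨hs, ?_⟩
  rw [← abs_of_nonneg hs, abs_div]
  exact div_le_one_of_le₀ h (abs_nonneg _)

theorem aux_neg {a b : ℝ} (h : |a| ≤ |b|) (hs : a / b ≤ 0) : 0 ≤ -(a / b) ∧ -(a / b) ≤ 1 := by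
  refine ⟨by linarith, ?_⟩
  rw [← abs_of_nonpos hs, abs_div]
  exact div_le_one_of_le₀ h (abs_nonneg _)

theorem P5_le_four (r : Fin 5 → ℝ)
    (hr : ∀ i, r i ≠ 0)
    (hmono : ∀ i j : Fin 5, i ≤ j → |r i| ≤ |r j|)
    (hr0 : 0 < r 0)
    (hneg : (Finset.univ.filter (fun i : Fin 5 => r i < 0)).card = 1 ∨
            (Finset.univ.filter (fun i : Fin 5 => r i < 0)).card = 4) :
    (∏ p ∈ Finset.univ.filter (fun p : Fin 5 × Fin 5 => p.1 < p.2),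
      |1 - r p.1 / r p.2| ^ 2) ≤ 4 := by
  have h1 := hr 1
  have h2 := hr 2
  have h3 := hr 3
  have h4 := hr 4
  have key : (∏ p ∈ Finset.univ.filter (fun p : Fin 5 × Fin 5 => p.1 < p.2),
      |1 - r p.1 / r p.2| ^ 2) = QQ (r 0 / r 1) (r 1 / r 2) (r 2 / r 3) (r 3 / r 4) ^ 2 := by
    have e : (Finset.univ.filter (fun p : Fin 5 × Fin 5 => p.1 < p.2)) =
      {(0,1),(0,2),(0,3),(0,4),(1,2),(1,3),(1,4),(2,3),(2,4),(3,4)} := by decide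
    rw [e]
    simp only [sq_abs, QQ, div_mul_div_cancel₀ h1, div_mul_div_cancel₀ h2, div_mul_div_cancel₀ h3]
    rw [Finset.prod_pow]
    congr 1
    repeat rw [Finset.prod_insert (by decide)]
    rw [Finset.prod_singleton]
    ring
  rw [key]
  suffices h : 0 ≤ QQ (r 0 / r 1) (r 1 / r 2) (r 2 / r 3) (r 3 / r 4) ∧
      QQ (r 0 / r 1) (r 1 / r 2) (r 2 / r 3) (r 3 / r 4) ≤ 2 by
    nlinarith [h.1, h.2]
  have m0 := hmono 0 1 (by decide)
  have m1 := hmono 1 2 (by decide)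
  have m2 := hmono 2 3 (by decide)
  have m3 := hmono 3 4 (by decide)
  simp only [Finset.card_filter, Fin.sum_univ_five, if_neg hr0.not_gt] at hneg
  have pp : ∀ {a b : ℝ}, 0 < a → 0 < b → |a| ≤ |b| → 0 ≤ a / b ∧ a / b ≤ 1 :=
    fun ha hb h => aux_pos h (div_nonneg ha.le hb.le)
  have nn : ∀ {a b : ℝ}, a < 0 → b < 0 → |a| ≤ |b| → 0 ≤ a / b ∧ a / b ≤ 1 :=
    fun ha hb h => aux_pos h (div_nonneg_of_nonpos ha.le hb.le)
  have pn : ∀ {a b : ℝ}, 0 < a → b < 0 → |a| ≤ |b| → 0 ≤ -(a / b) ∧ -(a / b) ≤ 1 :=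
    fun ha hb h => aux_neg h (div_nonpos_of_nonneg_of_nonpos ha.le hb.le)
  have np : ∀ {a b : ℝ}, a < 0 → 0 < b → |a| ≤ |b| → 0 ≤ -(a / b) ∧ -(a / b) ≤ 1 :=
    fun ha hb h => aux_neg h (div_nonpos_of_nonpos_of_nonneg ha.le hb.le)
  rcases lt_or_gt_of_ne h1 with s1 | s1 <;> rcases lt_or_gt_of_ne h2 with s2 | s2 <;>
  rcases lt_or_gt_of_ne h3 with s3 | s3 <;> rcases lt_or_gt_of_ne h4 with s4 | s4 <;>
  simp only [s1, s2, s3, s4, s1.not_gt, s2.not_gt, s3.not_gt, s4.not_gt, if_true, if_false] at hneg <;>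
  first
  | (exfalso; revert hneg; decide)
  | simpa only [neg_neg] using case1 (pn hr0 s1 m0) (nn s1 s2 m1) (nn s2 s3 m2) (nn s3 s4 m3)
  | simpa only [neg_neg] using case2 (pn hr0 s1 m0) (np s1 s2 m1) (pp s2 s3 m2) (pp s3 s4 m3)
  | simpa only [neg_neg] using case3 (pp hr0 s1 m0) (pn s1 s2 m1) (np s2 s3 m2) (pp s3 s4 m3)
  | simpa only [neg_neg] using case4 (pp hr0 s1 m0) (pp s1 s2 m1) (pn s2 s3 m2) (np s3 s4 m3)
  | simpa only [neg_neg] using case5 (pp hr0 s1 m0) (pp s1 s2 m1) (pp s2 s3 m2) (pn s3 s4 m3)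
end

section
/- Let k be a number field of degree 7 over ℚ having exactly 5 real infinite places (and 1 complex place), and suppose its regulator satisfies R_k ≤ 3.2. Then the discriminant D_k of k satisfies log|D_k| < 31.492. -/
/-- normalized distance -/
noncomputable def rr (x y : ℝ) : ℝ := |x - y| / max |x| |y|

lemma rr_comm (x y : ℝ) : rr x y = rr y x := by
  unfold rr; rw [abs_sub_comm, max_comm]

lemma rr_nonneg (x y : ℝ) : 0 ≤ rr x y := by
  unfold rr; positivity

lemma rr_eq {x y : ℝ} (hx : x ≠ 0) (h : |y| ≤ |x|) : rr x y = 1 - y / x := by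
  unfold rr
  rw [max_eq_left h, ← abs_div, sub_div, div_self hx, abs_of_nonneg]
  have : |y / x| ≤ 1 := by rw [abs_div]; exact div_le_one_of_le₀ h (abs_nonneg _)
  linarith [abs_le.1 this]

/-- `|x| ≤ y` -/
lemma T2 {x y : ℝ} (hy : y ≤ 1) (h : |x| ≤ y) : (1 - y) * (1 - x) ≤ 1 := by
  rw [abs_le] at h
  nlinarith [mul_nonneg (sub_nonneg.2 hy) (by linarith : 0 ≤ x + y), sq_nonneg y]

lemma abs_mul_le_left {x y z : ℝ} (h : |x| ≤ z) (hy : |y| ≤ 1) : |x * y| ≤ z := by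
  rw [abs_mul]; nlinarith [abs_nonneg x, abs_nonneg y]

lemma x3_aux {d w : ℝ} (h' : 0 ≤ d) (d1 : d ≤ 1) (w0 : 0 ≤ w) (w1 : w ≤ 1) :
    (2-w)*((1-d^2)*(1+d*w)) ≤ 2 := by
  have e : (2-w)*((1-d^2)*(1+d*w)) = (1-d^2)*(2 + w*(2*d-1) - d*w^2) := by ring
  rw [e]
  have dd : 0 ≤ 1 - d^2 := by nlinarith
  rcases le_total d (1/2) with hh | hh
  · have : 2 + w*(2*d-1) - d*w^2 ≤ 2 := by
      have := mul_nonneg w0 (by linarith : 0 ≤ 1 - 2*d)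
      have := mul_nonneg h' (sq_nonneg w)
      linarith
    calc _ ≤ (1-d^2)*2 := by gcongr
      _ ≤ 2 := by nlinarith [sq_nonneg d]
  · have : 2 + w*(2*d-1) - d*w^2 ≤ 9/4 := by
      have h1 := mul_nonneg (sub_nonneg.2 d1) (mul_nonneg w0 (by linarith : 0 ≤ 2 - w))
      have := sq_nonneg (w - 1/2)
      linarith
    have d2 : 1 - d^2 ≤ 3/4 := by nlinarith
    calc _ ≤ (1-d^2)*(9/4) := by gcongr
      _ ≤ 2 := by linarith

lemma T3 {a b : ℝ} (ha : |a| ≤ 1) (hb : |b| ≤ 1) : (1 - a) * (1 - b) * (1 - a * b) ≤ 2 := by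
  rw [abs_le] at ha hb
  rcases le_total 0 a with h | h <;> rcases le_total 0 b with h' | h'
  · have : a * b ≤ 1 := by nlinarith
    have h1 : (1 - a) * (1 - b) ≤ 1 := by nlinarith
    nlinarith [mul_nonneg h h', mul_nonneg (sub_nonneg.2 ha.2) (sub_nonneg.2 hb.2)]
  · have h1 : (1 - a) * (1 - a * b) ≤ 1 := T2 ha.2 (abs_mul_le_left (abs_of_nonneg h).le (abs_le.2 hb))
    have h2 : 0 ≤ (1 - a) * (1 - a * b) := mul_nonneg (by linarith) (by nlinarith)
    nlinarith
  · have h1 : (1 - b) * (1 - a * b) ≤ 1 := T2 hb.2 (by rw [mul_comm]; exact abs_mul_le_left (abs_of_nonneg h').le (abs_le.2 ha))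
    have h2 : 0 ≤ (1 - b) * (1 - a * b) := mul_nonneg (by linarith) (by nlinarith)
    nlinarith
  · have h1 : 0 ≤ a * b := by nlinarith
    have h3 : a * b ≤ 1 := by nlinarith
    nlinarith [mul_nonneg (add_nonneg zero_le_one zero_le_one (α := ℝ)) h1, mul_nonneg (by linarith : 0 ≤ 1 + a) (by linarith : 0 ≤ 1 + b), mul_nonneg h1 (mul_nonneg (by linarith : 0 ≤ 1 + a) (by linarith : 0 ≤ 1 + b)), sq_nonneg (a * b)]

lemma one_sub_nn {x : ℝ} (h : |x| ≤ 1) : 0 ≤ 1 - x := by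
  rw [abs_le] at h; linarith
lemma one_sub_le_two {x : ℝ} (h : |x| ≤ 1) : 1 - x ≤ 2 := by
  rw [abs_le] at h; linarith

def P5 (a b c d : ℝ) : ℝ := (1-a)*(1-b)*(1-c)*(1-d)*(1-a*b)*(1-b*c)*(1-c*d)*(1-a*b*c)*(1-b*c*d)*(1-a*b*c*d)

lemma P5_pos_e {a b c d : ℝ} (ha : |a| ≤ 1) (hb : |b| ≤ 1) (hc : |c| ≤ 1) (hd : |d| ≤ 1)
    (he : 0 ≤ b * c) : P5 a b c d ≤ 4 := by
  have he1 : |b * c| ≤ 1 := abs_mul_le_left hb hc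
  have key : (1-b*c)*(1-a*(b*c))*(1-(b*c)*d)*(1-a*(b*c)*d) ≤ 1 := by
    set e := b * c
    rw [abs_of_nonneg he] at he1
    have hae : |a * e| ≤ e := by rw [mul_comm]; exact abs_mul_le_left (abs_of_nonneg he).le ha
    have hed : |e * d| ≤ e := abs_mul_le_left (abs_of_nonneg he).le hd
    have haed : |a * e * d| ≤ e := abs_mul_le_left hae hd
    have n1 := one_sub_nn (hae.trans he1)
    have n2 := one_sub_nn (hed.trans he1)
    have n3 := one_sub_nn (haed.trans he1)
    have n0 : 0 ≤ 1 - e := by linarith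
    rcases le_total 0 d with h | h
    · have h1 := T2 he1 hae
      have h2 : (1 - e * d) * (1 - a * e * d) ≤ 1 := by
        apply T2 (by linarith [abs_le.1 hed])
        have : a * e * d = (e * d) * a := by ring
        rw [this]
        exact abs_mul_le_left (abs_of_nonneg (mul_nonneg he h)).le ha
      calc _ = ((1-e)*(1-a*e))*((1-e*d)*(1-a*e*d)) := by ring
        _ ≤ 1 * 1 := by gcongr
        _ = 1 := by norm_num
    · rcases le_total 0 a with h' | h'
      · have h1 := T2 he1 hed
        have h2 : (1 - a * e) * (1 - a * e * d) ≤ 1 := by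
          apply T2 (by linarith [abs_le.1 hae])
          exact abs_mul_le_left (abs_of_nonneg (mul_nonneg h' he)).le hd
        calc _ = ((1-e)*(1-e*d))*((1-a*e)*(1-a*e*d)) := by ring
          _ ≤ 1 * 1 := by gcongr
          _ = 1 := by norm_num
      · rw [abs_le] at ha hd
        have p0 : 0 ≤ a * d := by nlinarith
        have p1 : a * d ≤ 1 := by nlinarith
        have h1 : (1 - a*e)*(1-e*d) ≤ (1+e)*(1+a*d*e) := by
          nlinarith [mul_nonneg he (mul_nonneg (by linarith : 0 ≤ 1 + a) (by linarith : 0 ≤ 1 + d))]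
        have q0 : 0 ≤ a * d * e := by positivity
        have q1 : a * d * e ≤ 1 := by nlinarith
        calc _ = ((1-a*e)*(1-e*d))*((1-e)*(1-a*e*d)) := by ring
          _ ≤ ((1+e)*(1+a*d*e))*((1-e)*(1-a*e*d)) := by gcongr
          _ = (1-e^2)*(1-(a*d*e)^2) := by ring
          _ ≤ 1 * 1 := by
            have : e^2 ≤ 1 := by nlinarith
            have : (a*d*e)^2 ≤ 1 := by nlinarith
            apply mul_le_mul <;> nlinarith [sq_nonneg e, sq_nonneg (a*d*e)]
          _ = 1 := by norm_num
  have h1 := T3 ha hb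
  have h2 := T3 hc hd
  have m0 : 0 ≤ (1-b*c)*(1-a*(b*c))*(1-(b*c)*d)*(1-a*(b*c)*d) := by
    have := abs_mul_le_left ha he1
    have := one_sub_nn (abs_mul_le_left this hd)
    have := one_sub_nn (abs_mul_le_left he1 hd)
    have := one_sub_nn (abs_mul_le_left ha he1)
    have := one_sub_nn he1
    positivity
  have m1 : 0 ≤ (1-c)*(1-d)*(1-c*d) := by
    have := one_sub_nn hc; have := one_sub_nn hd; have := one_sub_nn (abs_mul_le_left hc hd)
    positivity
  calc P5 a b c d = ((1-a)*(1-b)*(1-a*b))*((1-c)*(1-d)*(1-c*d))*((1-b*c)*(1-a*(b*c))*(1-(b*c)*d)*(1-a*(b*c)*d)) := by unfold P5; ring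
    _ ≤ 2 * 2 * 1 := by gcongr
    _ = 4 := by norm_num

set_option maxHeartbeats 800000 in
lemma P5_neg_e {a b c d : ℝ} (ha : |a| ≤ 1) (hb : 0 ≤ b) (hb1 : b ≤ 1) (hc : c ≤ 0) (hc1 : -1 ≤ c)
    (hd : |d| ≤ 1) : P5 a b c d ≤ 4 := by
  obtain ⟨g, rfl⟩ : ∃ g, c = -g := ⟨-c, by ring⟩
  have g0 : 0 ≤ g := by linarith
  have g1 : g ≤ 1 := by linarith
  have hg : |g| ≤ 1 := abs_le.2 ⟨by linarith, g1⟩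
  have hng : |-g| ≤ 1 := abs_le.2 ⟨by linarith, by linarith⟩
  have hab : |b| ≤ b := (abs_of_nonneg hb).le
  have hb' : |b| ≤ 1 := hab.trans hb1
  have e0 : 0 ≤ b * g := by positivity
  have eb : b * g ≤ b := by nlinarith
  have e1 : b * g ≤ 1 := by linarith
  have he : |b * g| ≤ 1 := abs_le.2 ⟨by linarith, e1⟩
  have n1 := one_sub_nn ha
  have n2 := one_sub_nn hb'
  have n3 := one_sub_nn hng
  have n4 := one_sub_nn hd
  have n5 := one_sub_nn (abs_mul_le_left ha hb')
  have n6 := one_sub_nn (abs_mul_le_left hb' hng)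
  have n7 := one_sub_nn (abs_mul_le_left hng hd)
  have n8 := one_sub_nn (abs_mul_le_left (abs_mul_le_left ha hb') hng)
  have n9 := one_sub_nn (abs_mul_le_left (abs_mul_le_left hb' hng) hd)
  have n10 := one_sub_nn (abs_mul_le_left (abs_mul_le_left (abs_mul_le_left ha hb') hng) hd)
  have t3 := T3 hng hd
  rcases le_total 0 a with h | h
  · have a1 := (abs_le.1 ha).2
    have k1 : (1-b)*(1-b*(-g)) ≤ 1 := T2 hb1 (abs_mul_le_left hab hng)
    have k2 : (1-a)*(1-a*b*(-g)) ≤ 1 := T2 a1 (abs_mul_le_left (abs_mul_le_left (abs_of_nonneg h).le hb') hng)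
    have k3 : (1-a*b)*(1-a*b*(-g)*d) ≤ 1 := T2 (by nlinarith) (abs_mul_le_left (abs_mul_le_left (abs_of_nonneg (mul_nonneg h hb)).le hng) hd)
    have k4 : 1-b*(-g)*d ≤ 2 := one_sub_le_two (abs_mul_le_left (abs_mul_le_left hb' hng) hd)
    calc P5 a b (-g) d = ((1-b)*(1-b*(-g)))*((1-a)*(1-a*b*(-g)))*((1-a*b)*(1-a*b*(-g)*d))*((1-(-g))*(1-d)*(1-(-g)*d))*(1-b*(-g)*d) := by unfold P5; ring
      _ ≤ 1 * 1 * 1 * 2 * 2 := by gcongr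
      _ = 4 := by norm_num
  · obtain ⟨α, rfl⟩ : ∃ α, a = -α := ⟨-a, by ring⟩
    have α0 : 0 ≤ α := by linarith
    have α1 : α ≤ 1 := by linarith [(abs_le.1 ha).1]
    have m1 : (1+α*b)*(1-b) ≤ 1 - b*(1-α) := by nlinarith [mul_nonneg α0 (sq_nonneg b)]
    have m2 : (1-α*(b*g))*(1+b*g) ≤ 1+(b*g)*(1-α) := by nlinarith [mul_nonneg α0 (sq_nonneg (b*g))]
    have w0 : 0 ≤ 1 - α := by linarith
    have m0 : 0 ≤ 1-α*(b*g) := by linarith [n8]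
    have q : ((1+α*b)*(1-b))*((1-α*(b*g))*(1+b*g)) ≤ 1 := by
      calc _ ≤ (1 - b*(1-α)) * (1+(b*g)*(1-α)) := by
            apply mul_le_mul m1 m2 (by positivity); nlinarith
        _ ≤ (1 - b*(1-α)) * (1+b*(1-α)) := by
            apply mul_le_mul_of_nonneg_left _ (by nlinarith)
            nlinarith
        _ ≤ 1 := by nlinarith [sq_nonneg (b*(1-α))]
    have q0 : 0 ≤ ((1+α*b)*(1-b))*((1-α*(b*g))*(1+b*g)) := by positivity
    rcases le_total d 0 with h' | h'
    · have k3 : (1-b*(-g)*d) * (1-(-α)*b*(-g)*d) ≤ 1 := by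
        have e1 : b * (-g) * d = b*g*(-d) := by ring
        apply T2
        · rw [e1]; nlinarith [(abs_le.1 hd).1]
        · have : (-α)*b*(-g)*d = (b*(-g)*d)*(-α) := by ring
          rw [this]
          apply abs_mul_le_left _ ha
          rw [abs_of_nonneg]
          rw [e1]; exact mul_nonneg e0 (by linarith)
      calc P5 (-α) b (-g) d = (1+α)*(((1+α*b)*(1-b))*((1-α*(b*g))*(1+b*g)))*((1-(-g))*(1-d)*(1-(-g)*d))*((1-b*(-g)*d) * (1-(-α)*b*(-g)*d)) := by unfold P5; ring
        _ ≤ 2 * 1 * 2 * 1 := by gcongr; linarith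
        _ = 4 := by norm_num
    · have d1 := (abs_le.1 hd).2
      have dd : 0 ≤ 1 - d^2 := by nlinarith
      have x1 : (1-d)*(1+g*d) ≤ 1-d^2 := by nlinarith [mul_nonneg h' (sub_nonneg.2 g1), mul_nonneg (mul_nonneg h' (sub_nonneg.2 g1)) n4]
      have edd : b*g*d ≤ d := by nlinarith
      have ed0 : 0 ≤ b*g*d := by positivity
      have x2 : (1+b*g*d)*(1-α*(b*g*d)) ≤ 1 + d*(1-α) := by nlinarith [mul_nonneg α0 (sq_nonneg (b*g*d))]
      have x3 : (1+α)*((1-d^2)*(1+d*(1-α))) ≤ 2 := by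
        have := x3_aux h' d1 w0 (by linarith)
        have e : 2 - (1 - α) = 1 + α := by ring
        rwa [e] at this
      have m3 : 0 ≤ 1-α*(b*g*d) := by linarith [n10]
      calc P5 (-α) b (-g) d = (1+α)*(((1+α*b)*(1-b))*((1-α*(b*g))*(1+b*g)))*(1+g)*(((1-d)*(1+g*d))*((1+b*g*d)*(1-α*(b*g*d)))) := by unfold P5; ring
        _ ≤ (1+α)*1*2*((1-d^2)*(1 + d*(1-α))) := by
            gcongr; linarith
        _ ≤ 4 := by linarith

lemma P5_le {a b c d : ℝ} (ha : |a| ≤ 1) (hb : |b| ≤ 1) (hc : |c| ≤ 1) (hd : |d| ≤ 1) :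
    P5 a b c d ≤ 4 := by
  rcases le_total 0 (b * c) with h | h
  · exact P5_pos_e ha hb hc hd h
  · have hb' := abs_le.1 hb
    have hc' := abs_le.1 hc
    rcases mul_nonpos_iff.1 h with ⟨h1, h2⟩ | ⟨h1, h2⟩
    · exact P5_neg_e ha h1 hb'.2 h2 hc'.1 hd
    · have := P5_neg_e hd h2 hc'.2 h1 hb'.1 ha
      have e : P5 a b c d = P5 d c b a := by unfold P5; ring
      rw [e]; exact this

lemma rr_le_two {x y : ℝ} (hx : x ≠ 0) : rr x y ≤ 2 := by
  unfold rr
  have : 0 < max |x| |y| := lt_max_of_lt_left (abs_pos.2 hx)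
  rw [div_le_iff₀ this]
  have := abs_sub x y
  linarith [le_max_left |x| |y|, le_max_right |x| |y|]

lemma rr_le_one {x y : ℝ} (h : 0 < x * y) : rr x y ≤ 1 := by
  unfold rr
  apply div_le_one_of_le₀ _ (by positivity)
  rcases pos_and_pos_or_neg_and_neg_of_mul_pos h with ⟨h1, h2⟩ | ⟨h1, h2⟩
  · rw [abs_of_pos h1, abs_of_pos h2, abs_le]
    constructor <;> linarith [le_max_left x y, le_max_right x y]
  · rw [abs_of_neg h1, abs_of_neg h2, abs_le]
    constructor <;> linarith [le_max_left (-x) (-y), le_max_right (-x) (-y)]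

lemma rr_T3_sorted {x y w : ℝ} (hx : x ≠ 0) (hy : y ≠ 0) (h1 : |y| ≤ |x|) (h2 : |w| ≤ |y|) :
    rr x y * rr y w * rr x w ≤ 2 := by
  rw [rr_eq hx h1, rr_eq hy h2, rr_eq hx (h2.trans h1)]
  have e : w / x = (y / x) * (w / y) := by field_simp
  rw [e]
  apply T3 <;> rw [abs_div] <;> apply div_le_one_of_le₀ _ (abs_nonneg _) <;> assumption

lemma rr_T3 {x y w : ℝ} (hx : x ≠ 0) (hy : y ≠ 0) (hw : w ≠ 0) :
    rr x y * rr y w * rr x w ≤ 2 := by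
  have c1 := rr_comm x y
  have c2 := rr_comm y w
  have c3 := rr_comm x w
  rcases le_total |x| |y| with h1 | h1 <;> rcases le_total |y| |w| with h2 | h2 <;>
    rcases le_total |x| |w| with h3 | h3
  · have := rr_T3_sorted hw hy h2 h1; rw [c1, c2, c3]; linarith
  · have := rr_T3_sorted hw hy h2 h1; rw [c1, c2, c3]; linarith
  · have := rr_T3_sorted hy hw h2 h3; rw [c1, c3]; linarith
  · have := rr_T3_sorted hy hx h1 h3; rw [c1]; linarith
  · have := rr_T3_sorted hw hx h3 h1; rw [c2, c3]; linarith
  · have := rr_T3_sorted hx hw h3 h2; rw [c2]; linarith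
  · have := rr_T3_sorted hx hy h1 h2; linarith
  · have := rr_T3_sorted hx hy h1 h2; linarith

/-- product over all pairs of five reals -/
noncomputable def R5 (x : Fin 5 → ℝ) : ℝ :=
  rr (x 0) (x 1) * rr (x 0) (x 2) * rr (x 0) (x 3) * rr (x 0) (x 4) * rr (x 1) (x 2) * rr (x 1) (x 3)
   * rr (x 1) (x 4) * rr (x 2) (x 3) * rr (x 2) (x 4) * rr (x 3) (x 4)

lemma R5_nonneg (x : Fin 5 → ℝ) : 0 ≤ R5 x := by
  unfold R5 rr
  positivity

lemma R5_sorted {x : Fin 5 → ℝ} (hx : ∀ i, x i ≠ 0) (h : Antitone fun i => |x i|) : R5 x ≤ 4 := by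
  have key : ∀ i j : Fin 5, i ≤ j → rr (x i) (x j) = 1 - x j / x i := fun i j hij => rr_eq (hx i) (h hij)
  have k2 : ∀ i j : Fin 5, i ≤ j → |x j / x i| ≤ 1 := fun i j hij => by
    rw [abs_div]; exact div_le_one_of_le₀ (h hij) (abs_nonneg _)
  have := P5_le (k2 0 1 (by decide)) (k2 1 2 (by decide)) (k2 2 3 (by decide)) (k2 3 4 (by decide))
  unfold R5
  rw [key 0 1 (by decide), key 0 2 (by decide), key 0 3 (by decide), key 0 4 (by decide),
    key 1 2 (by decide), key 1 3 (by decide), key 1 4 (by decide), key 2 3 (by decide), key 2 4 (by decide), key 3 4 (by decide)]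
  have h0 := hx 0; have h1 := hx 1; have h2 := hx 2; have h3 := hx 3
  have e1 : x 2 / x 0 = x 1 / x 0 * (x 2 / x 1) := by field_simp
  have e2 : x 3 / x 0 = x 1 / x 0 * (x 2 / x 1) * (x 3 / x 2):= by field_simp
  have e3 : x 4 / x 0 = x 1 / x 0 * (x 2 / x 1) * (x 3 / x 2) * (x 4 / x 3) := by field_simp
  have e4 : x 3 / x 1 = (x 2 / x 1) * (x 3 / x 2):= by field_simp
  have e5 : x 4 / x 1 = (x 2 / x 1) * (x 3 / x 2) * (x 4 / x 3) := by field_simp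
  have e6 : x 4 / x 2 = (x 3 / x 2) * (x 4 / x 3) := by field_simp
  rw [e1, e2, e3, e4, e5, e6]
  unfold P5 at this
  linarith

lemma R5_sq (x : Fin 5 → ℝ) : R5 x ^ 2 = ∏ i, ∏ j, if i = j then 1 else rr (x i) (x j) := by
  simp only [Fin.prod_univ_five]
  simp only [Fin.isValue, if_true, Fin.reduceEq, if_false]
  rw [rr_comm (x 1) (x 0), rr_comm (x 2) (x 0), rr_comm (x 3) (x 0), rr_comm (x 4) (x 0),
   rr_comm (x 2) (x 1), rr_comm (x 3) (x 1), rr_comm (x 4) (x 1), rr_comm (x 3) (x 2),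
   rr_comm (x 4) (x 2), rr_comm (x 4) (x 3)]
  unfold R5; ring

lemma R5_perm (x : Fin 5 → ℝ) (σ : Equiv.Perm (Fin 5)) : R5 (x ∘ σ) = R5 x := by
  have : R5 (x ∘ σ) ^ 2 = R5 x ^ 2 := by
    rw [R5_sq, R5_sq, ← Equiv.prod_comp σ (fun i => ∏ j, if i = j then 1 else rr (x i) (x j))]
    apply Finset.prod_congr rfl; intro i _
    rw [← Equiv.prod_comp σ (fun j => if σ i = j then 1 else rr (x (σ i)) (x j))]
    apply Finset.prod_congr rfl; intro j _
    simp
  exact (sq_eq_sq₀ (R5_nonneg _) (R5_nonneg _)).1 this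

lemma R5_le {x : Fin 5 → ℝ} (hx : ∀ i, x i ≠ 0) : R5 x ≤ 4 := by
  let σ := Tuple.sort (fun i => -|x i|)
  have hm := Tuple.monotone_sort (fun i => -|x i|)
  rw [← R5_perm x σ]
  apply R5_sorted (fun i => hx _)
  intro i j hij
  have := hm hij
  simp only [Function.comp] at this ⊢
  linarith

/-- normalized distance to the complex point, `c` the cosine -/
noncomputable def fc (c x : ℝ) : ℝ := (x ^ 2 - 2 * c * x + 1) / (max |x| 1) ^ 2

lemma fc_eq (c x : ℝ) : ∃ t : ℝ, |t| ≤ 1 ∧ fc c x = 1 - 2 * c * t + t ^ 2 ∧ (0 ≤ c * x → 0 ≤ c * t) ∧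
    ((|x| ≤ 1 ∧ t = x) ∨ (1 ≤ |x| ∧ t = x⁻¹)) := by
  rcases le_total |x| 1 with h | h
  · refine ⟨x, h, ?_, id, Or.inl ⟨h, rfl⟩⟩
    unfold fc; rw [max_eq_right h]; ring
  · have hx : x ≠ 0 := by rintro rfl; norm_num at h
    refine ⟨x⁻¹, ?_, ?_, ?_, Or.inr ⟨h, rfl⟩⟩
    · rw [abs_inv]; exact inv_le_one_of_one_le₀ h
    · unfold fc; rw [max_eq_left h, sq_abs]; field_simp
    · intro h
      have : c * x⁻¹ = c * x * (x⁻¹)^2 := by field_simp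
      rw [this]; positivity

lemma fc_nonneg {c : ℝ} (hc : |c| ≤ 1) (x : ℝ) : 0 ≤ fc c x := by
  unfold fc
  apply div_nonneg _ (by positivity)
  rw [abs_le] at hc
  nlinarith [sq_nonneg (x - c)]

lemma fc_le {c : ℝ} (x : ℝ) : fc c x ≤ 2 + 2 * |c| := by
  obtain ⟨t, ht, e, -⟩ := fc_eq c x
  rw [e]
  have h1 : t ^ 2 ≤ 1 := by rw [← sq_abs]; nlinarith [abs_nonneg t]
  have h2 : |c * t| ≤ |c| := abs_mul_le_left le_rfl ht
  linarith [abs_le.1 h2]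

lemma fc_near {c : ℝ} (x : ℝ) (h : 0 ≤ c * x) : fc c x ≤ max 1 (2 - 2 * |c|) := by
  obtain ⟨t, ht, e, h', -⟩ := fc_eq c x
  rw [e]
  have h2 : c * t = |c| * |t| := by rw [← abs_mul, abs_of_nonneg (h' h)]
  have : 1 - 2 * c * t + t ^ 2 = 1 + |t| * (|t| - 2 * |c|) := by
    rw [mul_sub, ← sq, sq_abs]; linarith
  rw [this]
  have t0 := abs_nonneg t
  rcases le_total |t| (2 * |c|) with h | h
  · exact le_max_of_le_left (by nlinarith)
  · exact le_max_of_le_right (by nlinarith)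

lemma one_add_aux {u : ℝ} (h0 : 0 ≤ u) (h1 : u ≤ 1) : (1 + u) ^ 2 * (1 - u ^ 2) ≤ 27 / 16 := by
  nlinarith [sq_nonneg (u - 1/2), sq_nonneg ((u - 1/2) * u), sq_nonneg ((u-1/2)*(u+1)), mul_nonneg h0 (sq_nonneg (u - 1/2))]

lemma fc_le_sq {c t : ℝ} (hc : |c| ≤ 1) : 1 - 2 * c * t + t ^ 2 ≤ (1 + |t|) ^ 2 := by
  have : |c * t| ≤ |t| := by rw [mul_comm]; exact abs_mul_le_left le_rfl hc
  have := abs_le.1 this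
  nlinarith [sq_abs t]

lemma rr_inv {x y : ℝ} (hx : x ≠ 0) (hy : y ≠ 0) : rr x⁻¹ y⁻¹ = rr x y := by
  unfold rr
  have e : x⁻¹ - y⁻¹ = (y - x) * (x * y)⁻¹ := by field_simp
  rw [e, abs_mul, abs_inv, abs_mul, abs_inv, abs_inv, abs_sub_comm y x]
  have hx' := abs_pos.2 hx
  have hy' := abs_pos.2 hy
  rcases le_total |x| |y| with h | h
  · rw [max_eq_right h, max_eq_left (inv_anti₀ hx' h)]; field_simp
  · rw [max_eq_left h, max_eq_right (inv_anti₀ hy' h)]; field_simp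

lemma fcA {c x y : ℝ} (hc : |c| ≤ 1) (hxy : 0 < x * y) :
    fc c x * fc c y * rr x y ≤ (2 + 2 * |c|) * (27 / 16) := by
  obtain ⟨t, ht, et, -, ct⟩ := fc_eq c x
  obtain ⟨u, hu, eu, -, cu⟩ := fc_eq c y
  have hx : x ≠ 0 := by rintro rfl; simp at hxy
  have hy : y ≠ 0 := by rintro rfl; simp at hxy
  have key : ∀ {x y t u : ℝ}, |t| ≤ |u| → |t| ≤ 1 → |u| ≤ 1 → fc c x = 1 - 2 * c * t + t ^ 2 →
      rr x y ≤ 1 - t ^ 2 → fc c x * fc c y * rr x y ≤ (2 + 2 * |c|) * (27 / 16) := by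
    intro x y t u htu ht hu et hr
    have h1 : fc c x ≤ (1 + |t|)^2 := et ▸ fc_le_sq hc
    have h2 := one_add_aux (abs_nonneg t) ht
    calc fc c x * fc c y * rr x y = fc c y * (fc c x * rr x y) := by ring
      _ ≤ (2 + 2 * |c|) * ((1 + |t|)^2 * (1 - |t|^2)) := by
        have := rr_nonneg x y
        have := fc_nonneg hc x
        have := fc_nonneg hc y
        have := fc_le (c := c) y
        rw [sq_abs]
        gcongr
      _ ≤ _ := by gcongr
  have tu : 0 < t * u := by
    have e1 : x * y⁻¹ = x * y * (y⁻¹)^2 := by field_simp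
    have e2 : x⁻¹ * y = x * y * (x⁻¹)^2 := by field_simp
    have e3 : x⁻¹ * y⁻¹ = x * y * ((x * y)⁻¹)^2 := by field_simp
    rcases ct with ⟨_, rfl⟩ | ⟨_, rfl⟩ <;> rcases cu with ⟨_, rfl⟩ | ⟨_, rfl⟩
    · exact hxy
    · rw [e1]; positivity
    · rw [e2]; positivity
    · rw [e3]; positivity
  have t0 : t ≠ 0 := by rintro rfl; simp at tu
  have u0 : u ≠ 0 := by rintro rfl; simp at tu
  -- rr x y = rr t u or 1 - t u
  have hr : rr x y = rr t u ∨ rr x y = 1 - t * u := by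
    rcases ct with ⟨a, rfl⟩ | ⟨a, rfl⟩ <;> rcases cu with ⟨b, rfl⟩ | ⟨b, rfl⟩
    · left; rfl
    · right
      rw [rr_comm, rr_eq hy (a.trans b), div_eq_mul_inv]
    · right
      rw [rr_eq hx (b.trans a), div_eq_mul_inv, mul_comm]
    · left; rw [rr_inv hx hy]
  have key2 : ∀ {t u : ℝ}, 0 < t * u → |t| ≤ |u| → |u| ≤ 1 → rr t u ≤ 1 - t^2 ∧ 1 - t * u ≤ 1 - t ^2 := by
    intro t u tu h hu
    have u0 : u ≠ 0 := by rintro rfl; simp at tu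
    have e : t * u = |t| * |u| := by rw [← abs_mul, abs_of_pos tu]
    have e2 : t / u = |t| / |u| := by rw [← abs_div, abs_of_pos]; rw [show t / u = t * u * (u⁻¹)^2 by field_simp]; positivity
    have u1 := abs_pos.2 u0
    constructor
    · rw [rr_comm, rr_eq u0 h, e2, ← sq_abs t]
      have : |t| ^ 2 ≤ |t| / |u| := by
        rw [le_div_iff₀ u1]
        have : |t| ≤ 1 := h.trans hu
        nlinarith [abs_nonneg t, mul_nonneg (abs_nonneg t) (abs_nonneg t), mul_nonneg (mul_nonneg (abs_nonneg t) (abs_nonneg t)) (sub_nonneg.2 hu)]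
      linarith
    · rw [e, ← sq_abs t]; nlinarith [abs_nonneg t]
  rcases le_total |t| |u| with h | h
  · obtain ⟨h1, h2⟩ := key2 tu h hu
    apply key h ht hu et
    rcases hr with hr | hr <;> rw [hr] <;> assumption
  · obtain ⟨h1, h2⟩ := key2 (mul_comm t u ▸ tu) h ht
    have := key (y := x) h hu ht eu (by
      rw [rr_comm]
      rcases hr with hr | hr <;> rw [hr]
      · rwa [rr_comm]
      · rwa [mul_comm])
    rw [rr_comm] at this; linarith

lemma s1 {s C : ℝ} (hs : 0 ≤ s) (hC : 0 ≤ C) (hC1 : C ≤ 1) (h : s ^ 2 = 1 - C ^ 2) : s * (1 + C) ^ 2 ≤ 2.1 := by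
  apply le_of_sq_le_sq _ (by norm_num)
  rw [mul_pow, h]
  nlinarith [sq_nonneg (C - 2/3), sq_nonneg ((C-2/3)*C), sq_nonneg ((C-2/3)*(1+C)), mul_nonneg hC (sq_nonneg (C-2/3)), mul_nonneg hC (sq_nonneg ((C-2/3)*(1+C))), sq_nonneg ((C-2/3)*(1+C)^2)]

lemma s2 {s C : ℝ} (hs : 0 ≤ s) (hC : 0 ≤ C) (hC1 : C ≤ 1) (h : s ^ 2 = 1 - C ^ 2) : 64 * (s ^ 5 * (1 + C)) ≤ 70 := by
  have : s ^ 5 * (1 + C) ≤ 35/32 := by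
    apply le_of_sq_le_sq _ (by norm_num)
    have e : (s ^ 5 * (1 + C))^2 = (1 - C^2)^5 * (1+C)^2 := by rw [← h]; ring
    rw [e]
    have h1 : (1+C)^2 ≤ (35/32)^2 * (1+5*C^2+10*C^4) := by
      nlinarith [sq_nonneg (C^2 - 0.0306), sq_nonneg (C - 0.175)]
    have h2 : 1+5*C^2+10*C^4 ≤ (1+C^2)^5 := by
      have : (1+C^2)^5 = 1+5*C^2+10*C^4 + (10*C^6+5*C^8+C^10) := by ring
      rw [this]; have : 0 ≤ 10*C^6+5*C^8+C^10 := by positivity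
      linarith
    have h3 : 0 ≤ 1 - C^2 := by rw [← h]; positivity
    calc _ ≤ (1 - C^2)^5 * ((35/32)^2 * (1+C^2)^5) := by gcongr; linarith
      _ = (35/32)^2 * (1 - C^4)^5 := by ring
      _ ≤ (35/32)^2 * 1 := by
        gcongr
        apply pow_le_one₀
        · nlinarith [sq_nonneg C]
        · have : 0 ≤ C^4 := by positivity
          linarith
      _ = _ := by ring
  linarith

lemma numA {s C : ℝ} (hs : 0 ≤ s) (hC : 0 ≤ C) (hC1 : C ≤ 1) (h : s ^ 2 = 1 - C ^ 2) :
    2 * s * ((2 + 2 * C) ^ 3 * (max 1 (2 - 2 * C)) ^ 2) ≤ 70 := by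
  rcases le_total 1 (2 - 2 * C) with h1 | h1
  · rw [max_eq_right h1]
    have e : 2 * s * ((2 + 2 * C) ^ 3 * (2 - 2 * C) ^ 2) = 64 * (s ^ 5 * (1 + C)) := by
      have : s ^ 5 = s * (s^2)^2 := by ring
      rw [this, h]; ring
    rw [e]; exact s2 hs hC hC1 h
  · rw [max_eq_left h1]
    have := s1 hs hC hC1 h
    have : 0 ≤ s * (1 + C)^2 := by positivity
    nlinarith

lemma numB {s C : ℝ} (hs : 0 ≤ s) (hC : 0 ≤ C) (hC1 : C ≤ 1) (h : s ^ 2 = 1 - C ^ 2) :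
    s * (1 + C) ^ 2 * (max 1 (2 - 2 * C)) ≤ 3 := by
  rcases le_total 1 (2 - 2 * C) with h1 | h1
  · rw [max_eq_right h1]
    have hs1 : s ≤ 1 := by nlinarith
    have e : s * (1 + C) ^ 2 * (2 - 2 * C) = 2 * (s * ((1 - C^2) * (1 + C))) := by ring
    rw [e]
    have h2 : (1 - C^2) * (1 + C) ≤ 3 / 2 := by nlinarith
    have h3 : 0 ≤ (1 - C^2) * (1 + C) := by rw [← h]; positivity
    nlinarith
  · rw [max_eq_left h1]; linarith [s1 hs hC hC1 h]

lemma P_bound_A {c s : ℝ} {x : Fin 5 → ℝ} (hs : 0 ≤ s) (hcs : s ^ 2 = 1 - c ^ 2) (hc : |c| ≤ 1)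
    (hx : ∀ i, x i ≠ 0) {i j : Fin 5} (hij : i ≠ j) (hi : 0 ≤ c * x i) (hj : 0 ≤ c * x j) :
    R5 x * (∏ i, fc c (x i)) * (2 * s) ≤ 280 := by
  have h1 := R5_le hx
  have f0 : ∀ i, 0 ≤ fc c (x i) := fun i => fc_nonneg hc _
  have hj' : j ∈ Finset.univ.erase i := by simp [hij.symm]
  have h2 : ∏ i, fc c (x i) ≤ (2 + 2 * |c|) ^ 3 * (max 1 (2 - 2 * |c|)) ^ 2 := by
    rw [← Finset.mul_prod_erase _ _ (Finset.mem_univ i), ← Finset.mul_prod_erase _ _ hj']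
    have : ∏ k ∈ (Finset.univ.erase i).erase j, fc c (x k) ≤ ∏ k ∈ (Finset.univ.erase i).erase j, (2 + 2 * |c|) :=
      Finset.prod_le_prod (fun i _ => f0 i) (fun i _ => fc_le _)
    rw [Finset.prod_const, Finset.card_erase_of_mem hj', Finset.card_erase_of_mem (Finset.mem_univ i)] at this
    norm_num at this
    have p0 : 0 ≤ ∏ k ∈ (Finset.univ.erase i).erase j, fc c (x k) := Finset.prod_nonneg (fun i _ => f0 i)
    have := f0 i; have := f0 j; have := fc_near _ hi; have := fc_near _ hj
    calc _ ≤ max 1 (2 - 2 * |c|) * (max 1 (2 - 2 * |c|) * (2 + 2 * |c|) ^ 3) := by gcongr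
      _ = _ := by ring
  have h3 := numA hs (abs_nonneg c) hc (by rw [sq_abs]; exact hcs)
  have := Finset.prod_nonneg (fun i (_ : i ∈ Finset.univ) => f0 i)
  calc _ ≤ 4 * ((2 + 2 * |c|) ^ 3 * (max 1 (2 - 2 * |c|)) ^ 2) * (2 * s) := by gcongr
    _ ≤ 280 := by linarith

lemma P_bound_B {c s : ℝ} {x : Fin 5 → ℝ} (hs : 0 ≤ s) (hcs : s ^ 2 = 1 - c ^ 2) (hc : |c| ≤ 1)
    (hx : ∀ i, x i ≠ 0) (hi : ∀ i, i ≠ 0 → c * x i < 0) :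
    R5 x * (∏ i, fc c (x i)) * (2 * s) ≤ 280 := by
  have same : ∀ i j, c * x i < 0 → c * x j < 0 → 0 < x i * x j := by
    intro i j h1 h2
    have : 0 < c^2 * (x i * x j) := by nlinarith
    exact pos_of_mul_pos_right this (sq_nonneg c)
  have f0 : ∀ i, 0 ≤ fc c (x i) := fun i => fc_nonneg hc _
  have g1 := hi 1 (by decide)
  have g2 := hi 2 (by decide)
  have g3 := hi 3 (by decide)
  have g4 := hi 4 (by decide)
  have a12 := fcA hc (same 1 2 g1 g2)
  have a34 := fcA hc (same 3 4 g3 g4)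
  have b1 := rr_le_one (same 1 4 g1 g4)
  have b2 := rr_le_one (same 2 3 g2 g3)
  have b3 := rr_le_one (same 1 3 g1 g3)
  have b4 := rr_le_one (same 2 4 g2 g4)
  have f1 := f0 1; have f2 := f0 2; have f3 := f0 3; have f4 := f0 4; have f00 := f0 0
  have r01 := rr_nonneg (x 0) (x 1)
  have r02 := rr_nonneg (x 0) (x 2)
  have r03 := rr_nonneg (x 0) (x 3)
  have r04 := rr_nonneg (x 0) (x 4)
  have r12 := rr_nonneg (x 1) (x 2)
  have r13 := rr_nonneg (x 1) (x 3)
  have r14 := rr_nonneg (x 1) (x 4)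
  have r23 := rr_nonneg (x 2) (x 3)
  have r24 := rr_nonneg (x 2) (x 4)
  have r34 := rr_nonneg (x 3) (x 4)
  have hcs' : s ^ 2 = 1 - |c| ^ 2 := by rw [sq_abs]; exact hcs
  have e : R5 x * (∏ i, fc c (x i)) * (2 * s) =
    (rr (x 0) (x 1) * rr (x 1) (x 3) * rr (x 0) (x 3)) * (rr (x 0) (x 2) * rr (x 2) (x 4) * rr (x 0) (x 4)) *
    (fc c (x 1) * fc c (x 2) * rr (x 1) (x 2)) * (fc c (x 3) * fc c (x 4) * rr (x 3) (x 4)) *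
    (rr (x 1) (x 4) * rr (x 2) (x 3)) * fc c (x 0) * (2 * s) := by
    rw [Fin.prod_univ_five]; unfold R5; ring
  rw [e]
  rcases le_or_gt 0 (c * x 0) with h | h
  · have t1 := rr_T3 (hx 0) (hx 1) (hx 3)
    have t2 := rr_T3 (hx 0) (hx 2) (hx 4)
    have fn := fc_near _ h
    have hn := numB hs (abs_nonneg c) hc hcs'
    calc _ ≤ 2 * 2 * ((2 + 2 * |c|) * (27 / 16)) * ((2 + 2 * |c|) * (27 / 16)) * (1 * 1) * (max 1 (2 - 2 * |c|)) * (2 * s) := by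
          gcongr
      _ = 32 * (27/16)^2 * (s * (1 + |c|) ^ 2 * (max 1 (2 - 2 * |c|))) := by ring
      _ ≤ 32 * (27/16)^2 * 3 := by gcongr
      _ ≤ 280 := by norm_num
  · have c1 := rr_le_one (same 0 1 h g1)
    have c2 := rr_le_one (same 0 2 h g2)
    have c3 := rr_le_one (same 0 3 h g3)
    have c4 := rr_le_one (same 0 4 h g4)
    have fn := fc_le (c := c) (x 0)
    have hn := s1 hs (abs_nonneg c) hc hcs'
    calc _ ≤ (1 * 1 * 1) * (1 * 1 * 1) * ((2 + 2 * |c|) * (27 / 16)) * ((2 + 2 * |c|) * (27 / 16)) * (1 * 1) * (2 + 2 * 1) * (2 * s) := by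
          gcongr; linarith
      _ = 32 * (27/16)^2 * (s * (1 + |c|) ^ 2) := by ring
      _ ≤ 32 * (27/16)^2 * 2.1 := by gcongr
      _ ≤ 280 := by norm_num

lemma P_bound {c s : ℝ} {x : Fin 5 → ℝ} (hs : 0 ≤ s) (hcs : s ^ 2 = 1 - c ^ 2)
    (hx : ∀ i, x i ≠ 0) :
    R5 x * (∏ i, fc c (x i)) * (2 * s) ≤ 280 := by
  have hc : |c| ≤ 1 := by rw [← sq_le_one_iff_abs_le_one]; nlinarith [sq_nonneg s]
  by_cases h : ∃ i j, i ≠ j ∧ 0 ≤ c * x i ∧ 0 ≤ c * x j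
  · obtain ⟨i, j, h1, h2, h3⟩ := h
    exact P_bound_A hs hcs hc hx h1 h2 h3
  · obtain ⟨k, hk⟩ : ∃ k, ∀ i, i ≠ k → c * x i < 0 := by
      push Not at h
      by_cases h' : ∃ k, 0 ≤ c * x k
      · obtain ⟨k, hk⟩ := h'
        exact ⟨k, fun i hi => h k i hi.symm hk⟩
      · push Not at h'
        exact ⟨0, fun i _ => h' i⟩
    have := P_bound_B (x := x ∘ Equiv.swap 0 k) hs hcs hc (fun i => hx _) (fun i hi => by
      apply hk
      intro h
      apply hi
      have := congrArg (Equiv.swap 0 k) h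
      simpa using this)
    rw [R5_perm] at this
    simp only [Function.comp] at this
    rwa [Equiv.prod_comp (Equiv.swap 0 k) (fun i => fc c (x i))] at this

open Matrix in
def qf {n : ℕ} (G : Matrix (Fin n) (Fin n) ℝ) (v : Fin n → ℝ) : ℝ := v ⬝ᵥ (G *ᵥ v)

def PD {n : ℕ} (G : Matrix (Fin n) (Fin n) ℝ) : Prop := G.IsSymm ∧ ∀ x, x ≠ 0 → 0 < qf G x

noncomputable def schur {n : ℕ} (G : Matrix (Fin (n+1)) (Fin (n+1)) ℝ) : Matrix (Fin n) (Fin n) ℝ :=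
  Matrix.of fun i j => G i.succ j.succ - G i.succ 0 * G 0 j.succ / G 0 0

lemma schur_det {n : ℕ} (G : Matrix (Fin (n+1)) (Fin (n+1)) ℝ) (h : G 0 0 ≠ 0) :
    G.det = G 0 0 * (schur G).det := by
  have key : G.det = (Matrix.of fun i j => Fin.cases (motive := fun _ => ℝ) (G 0 j)
      (fun k => G k.succ j - G k.succ 0 * G 0 j / G 0 0) i).det := by
    apply Matrix.det_eq_of_forall_row_eq_smul_add_const (c := fun i => Fin.cases (motive := fun _ => ℝ) 0 (fun k => G k.succ 0 / G 0 0) i) (k := 0)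
    · simp
    · intro i j
      refine Fin.cases ?_ (fun k => ?_) i
      · simp
      · simp; ring
  rw [key, Matrix.det_succ_column_zero, Fin.sum_univ_succ]
  have : ∀ i : Fin n, G i.succ 0 - G i.succ 0 * G 0 0 / G 0 0 = 0 := by
    intro i; field_simp; simp
  simp [this]
  left
  congr 1

lemma qf_sum {n : ℕ} (G : Matrix (Fin n) (Fin n) ℝ) (v : Fin n → ℝ) :
    qf G v = ∑ i, ∑ j, v i * G i j * v j := by
  simp only [qf, dotProduct, Matrix.mulVec, Finset.mul_sum, mul_assoc]

lemma schur_qf {n : ℕ} (G : Matrix (Fin (n+1)) (Fin (n+1)) ℝ) (hs : G.IsSymm) (h : G 0 0 ≠ 0)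
    (t : ℝ) (x : Fin n → ℝ) : qf G (Fin.cons t x) =
    G 0 0 * (t + (∑ j, G 0 j.succ * x j) / G 0 0) ^ 2 + qf (schur G) x := by
  have e1 : qf (schur G) x = (∑ i, ∑ j, x i * G i.succ j.succ * x j)
      - (∑ j, G 0 j.succ * x j) ^ 2 / G 0 0 := by
    rw [qf_sum, sq, Finset.sum_mul_sum, Finset.sum_div, ← Finset.sum_sub_distrib]
    refine Finset.sum_congr rfl fun i _ => ?_
    rw [Finset.sum_div, ← Finset.sum_sub_distrib]
    refine Finset.sum_congr rfl fun j _ => ?_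
    simp only [schur, Matrix.of_apply, hs.apply 0 i.succ]
    ring
  have e2 : qf G (Fin.cons t x) = t ^ 2 * G 0 0 + 2 * t * (∑ j, G 0 j.succ * x j)
      + ∑ i, ∑ j, x i * G i.succ j.succ * x j := by
    rw [qf_sum, Fin.sum_univ_succ]
    simp only [Fin.sum_univ_succ, Fin.cons_zero, Fin.cons_succ, Finset.sum_add_distrib]
    have : ∑ i : Fin n, x i * G i.succ 0 * t = t * ∑ j, G 0 j.succ * x j := by
      rw [Finset.mul_sum]; refine Finset.sum_congr rfl fun i _ => ?_
      rw [hs.apply 0 i.succ]; ring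
    have h2 : ∑ i : Fin n, t * G 0 i.succ * x i = t * ∑ j, G 0 j.succ * x j := by
      rw [Finset.mul_sum]; refine Finset.sum_congr rfl fun i _ => ?_
      ring
    rw [this, h2]; ring
  rw [e1, e2]; field_simp; ring

lemma PD_pos {n : ℕ} {G : Matrix (Fin (n+1)) (Fin (n+1)) ℝ} (h : PD G) : 0 < G 0 0 := by
  have := h.2 (Pi.single 0 1) (by simp)
  simpa [qf] using this

lemma schur_PD {n : ℕ} {G : Matrix (Fin (n+1)) (Fin (n+1)) ℝ} (h : PD G) : PD (schur G) := by
  have h0 := PD_pos h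
  constructor
  · ext i j
    simp only [schur, Matrix.transpose_apply, Matrix.of_apply]
    rw [h.1.apply i.succ j.succ, h.1.apply 0 i.succ, h.1.apply 0 j.succ]; ring
  · intro x hx
    have := h.2 (Fin.cons (-((∑ j, G 0 j.succ * x j) / G 0 0)) x) (by
      intro h; apply hx; ext i; have := congrFun h i.succ; simpa using this)
    rw [schur_qf G h.1 h0.ne'] at this
    simpa using this

noncomputable def rmat {n : ℕ} (U : Matrix (Fin n) (Fin n) ℤ) : Matrix (Fin n) (Fin n) ℝ := U.map (Int.castRingHom ℝ)

lemma rmat_mul {n : ℕ} (U V : Matrix (Fin n) (Fin n) ℤ) : rmat (U * V) = rmat U * rmat V := by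
  simp only [rmat, Matrix.map_mul]

lemma rmat_det {n : ℕ} (U : Matrix (Fin n) (Fin n) ℤ) : (rmat U).det = (U.det : ℝ) := by
  rw [rmat, ← RingHom.mapMatrix_apply, ← RingHom.map_det]; simp

open Matrix in
lemma qf_conj {n : ℕ} (G M : Matrix (Fin n) (Fin n) ℝ) (v : Fin n → ℝ) :
    qf (Mᵀ * G * M) v = qf G (M *ᵥ v) := by
  simp only [qf, ← Matrix.mulVec_mulVec, Matrix.dotProduct_mulVec, Matrix.vecMul_transpose]

open Matrix in
lemma conj_PD {n : ℕ} {G M : Matrix (Fin n) (Fin n) ℝ} (h : PD G) (hM : IsUnit M.det) :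
    PD (Mᵀ * G * M) := by
  constructor
  · unfold Matrix.IsSymm
    simp only [Matrix.transpose_mul, Matrix.transpose_transpose, h.1.eq, Matrix.mul_assoc]
  · intro x hx
    rw [qf_conj]
    apply h.2
    intro h0
    apply hx
    have := congrArg (fun y => M⁻¹ *ᵥ y) h0
    simpa [Matrix.nonsing_inv_mul _ hM] using this

/-- extension matrix -/
def wmat {n : ℕ} (t : ℤ) (V : Matrix (Fin (n+1)) (Fin (n+1)) ℤ) :
    Matrix (Fin (n+2)) (Fin (n+2)) ℤ :=
  Matrix.of fun i j => Fin.cases (motive := fun _ => ℤ)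
    (Fin.cases (motive := fun _ => ℤ) 1 (fun k => if k = 0 then t else 0) j)
    (fun i => Fin.cases (motive := fun _ => ℤ) 0 (fun k => V i k) j) i

lemma wmat_det {n : ℕ} (t : ℤ) (V : Matrix (Fin (n+1)) (Fin (n+1)) ℤ) :
    (wmat t V).det = V.det := by
  rw [Matrix.det_succ_column_zero, Fin.sum_univ_succ]
  simp [wmat]
  congr 1

lemma exists_ext {n : ℕ} (t : ℤ) (V : Matrix (Fin (n+1)) (Fin (n+1)) ℤ) (hV : IsUnit V.det) :
    ∃ W : Matrix (Fin (n+2)) (Fin (n+2)) ℤ, IsUnit W.det ∧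
      ∀ i, W i 0 = Fin.cons (α := fun _ => ℤ) t (fun i => V i 0) i := by
  refine ⟨(wmat t V).submatrix id (Equiv.swap 0 1), ?_, ?_⟩
  · rw [Matrix.det_permute', wmat_det]
    refine IsUnit.mul ?_ hV
    simp
  · intro i
    rw [Matrix.submatrix_apply, Equiv.swap_apply_left]
    refine Fin.cases ?_ (fun k => ?_) i
    · rfl
    · rfl

open Matrix in
lemma hermite {τ : ℝ} (hτ : 4 / 3 < τ) (n : ℕ) : ∀ G : Matrix (Fin (n+1)) (Fin (n+1)) ℝ, PD G →
    0 < G.det ∧ ∃ U : Matrix (Fin (n+1)) (Fin (n+1)) ℤ, IsUnit U.det ∧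
      (qf G (fun i => (U i 0 : ℝ))) ^ (n + 1) ≤ τ ^ (n * (n + 1) / 2) * G.det := by
  induction n with
  | zero =>
    intro G hG
    have h0 := PD_pos hG
    refine ⟨by simpa using h0, 1, by simp, ?_⟩
    simp [qf_sum]
  | succ n ih =>
    intro G hG
    have h0 := PD_pos hG
    have hdet : 0 < G.det := by
      rw [schur_det G h0.ne']
      exact mul_pos h0 (ih _ (schur_PD hG)).1
    refine ⟨hdet, ?_⟩
    by_contra! hcon
    set B := τ ^ ((n + 1) * (n + 1 + 1) / 2) * G.det with hB
    have hBpos : 0 < B := by positivity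
    set S : Set ℝ := {y | ∃ U : Matrix (Fin (n+1+1)) (Fin (n+1+1)) ℤ, IsUnit U.det ∧
      y = qf G (fun i => (U i 0 : ℝ))} with hS
    have hSlow : ∀ y ∈ S, min B 1 ≤ y := by
      rintro y ⟨U, hU, rfl⟩
      have hc := hcon U hU
      by_contra! hlt
      have hy0 : 0 ≤ qf G (fun i => (U i 0 : ℝ)) := by
        by_cases hz : (fun i => (U i 0 : ℝ)) = 0
        · rw [hz]; simp [qf]
        · exact (hG.2 _ hz).le
      have h1 : qf G (fun i => (U i 0 : ℝ)) ≤ 1 := (hlt.trans_le (min_le_right _ _)).le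
      have h2 := hlt.trans_le (min_le_left _ _)
      have h3 := pow_le_of_le_one hy0 h1 (n := n + 1 + 1) (by omega)
      linarith
    have hne : S.Nonempty := ⟨_, 1, by simp, rfl⟩
    have hbdd : BddBelow S := ⟨_, hSlow⟩
    have hinf : 0 < sInf S := lt_of_lt_of_le (lt_min hBpos one_pos) (le_csInf hne hSlow)
    have hτ0 : 0 < τ := by linarith
    have hk : 1 / τ + 1 / 4 < 1 := by
      have : 1 / τ < 3 / 4 := by rw [div_lt_iff₀ hτ0]; linarith
      linarith
    have hk0 : 0 < 1 / τ + 1 / 4 := by positivity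
    obtain ⟨m, ⟨U, hU, hmU⟩, hm⟩ : ∃ m ∈ S, m < sInf S / (1 / τ + 1 / 4) := by
      apply exists_lt_of_csInf_lt hne
      rw [lt_div_iff₀ hk0]
      nlinarith
    rw [lt_div_iff₀ hk0] at hm
    have hUr : IsUnit (rmat U).det := by
      rw [rmat_det]; exact hU.map (Int.castRingHom ℝ)
    set G' := (rmat U)ᵀ * G * rmat U with hG'
    have hPD' : PD G' := conj_PD hG hUr
    have h0' := PD_pos hPD'
    have hUcol : ∀ W : Matrix (Fin (n+1+1)) (Fin (n+1+1)) ℤ,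
        qf G (fun i => ((U * W) i 0 : ℝ)) = qf G' (fun i => (W i 0 : ℝ)) := by
      intro W
      rw [hG', qf_conj]
      congr 1
      ext i
      simp [Matrix.mul_apply, rmat, Matrix.mulVec, dotProduct]
    have hm00 : m = G' 0 0 := by
      have := hUcol 1
      rw [mul_one] at this
      rw [hmU, this]
      have h1 : (fun i => (((1 : Matrix (Fin (n+1+1)) (Fin (n+1+1)) ℤ) i 0 : ℤ) : ℝ)) = Pi.single 0 1 := by
        ext i
        by_cases hi : i = 0
        · subst hi; simp
        · simp [hi]
      rw [h1]; simp [qf]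
    have hdet' : G'.det = G.det := by
      rw [hG', Matrix.det_mul, Matrix.det_mul, Matrix.det_transpose, rmat_det]
      have : (U.det : ℝ) * U.det = 1 := by
        exact_mod_cast Int.isUnit_mul_self hU
      linear_combination G.det * this
    obtain ⟨hHdet, V, hV, hVq⟩ := ih _ (schur_PD hPD')
    set β := (∑ j, G' 0 j.succ * (V j 0 : ℝ)) / G' 0 0 with hβ
    obtain ⟨W, hW, hWc⟩ := exists_ext (-round β) V hV
    have hval : qf G (fun i => ((U * W) i 0 : ℝ)) =
        G' 0 0 * (((-round β : ℤ) : ℝ) + β) ^ 2 + qf (schur G') (fun i => (V i 0 : ℝ)) := by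
      rw [hUcol, ← schur_qf G' hPD'.1 h0'.ne']
      congr 1
      ext i
      rw [hWc]
      refine Fin.cases ?_ (fun k => ?_) i
      · simp
      · simp
    have hmem : sInf S ≤ qf G (fun i => ((U * W) i 0 : ℝ)) := by
      apply csInf_le hbdd
      exact ⟨U * W, by rw [Matrix.det_mul]; exact hU.mul hW, rfl⟩
    have hround : (((-round β : ℤ) : ℝ) + β) ^ 2 ≤ 1 / 4 := by
      have := abs_sub_round β
      have h2 : ((-round β : ℤ) : ℝ) + β = β - round β := by push_cast; ring
      rw [h2, ← sq_abs]
      have h3 := abs_nonneg (β - round β)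
      nlinarith
    rw [hval] at hmem
    set h := qf (schur G') (fun i => (V i 0 : ℝ)) with hh
    have h0m : 0 < m := by rw [hm00]; exact h0'
    have hne0 := h0'.ne'
    rw [← hm00] at hmem
    have hmh : m ≤ τ * h := by
      have h1 : m * (((-round β : ℤ) : ℝ) + β) ^ 2 ≤ m * (1 / 4) :=
        mul_le_mul_of_nonneg_left hround h0m.le
      have h2 : m * (1 / τ) ≤ h := by linarith
      rw [mul_one_div, div_le_iff₀ hτ0] at h2
      linarith
    have hfin := hcon U hU
    rw [← hmU, hB, ← hdet', schur_det G' hne0, ← hm00] at hfin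
    have hexp : (n + 1) * (n + 1 + 1) / 2 = (n + 1) + n * (n + 1) / 2 := by
      have : (n + 1) * (n + 1 + 1) = n * (n + 1) + 2 * (n + 1) := by ring
      omega
    have h4 : m ^ (n + 1) ≤ τ ^ (n + 1) * (τ ^ (n * (n + 1) / 2) * (schur G').det) :=
      calc m ^ (n + 1) ≤ (τ * h) ^ (n + 1) := pow_le_pow_left₀ h0m.le hmh _
        _ = τ ^ (n + 1) * h ^ (n + 1) := mul_pow _ _ _
        _ ≤ _ := by gcongr
    rw [hexp, pow_add τ, pow_succ m] at hfin
    have h5 := mul_le_mul_of_nonneg_right h4 h0m.le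
    linarith

lemma pairs_prod {M : Type*} [CommMonoid M] (f : Fin 7 → Fin 7 → M) :
    ∏ i, ∏ j ∈ Finset.Ioi i, f i j =
    (f 0 1 * f 0 2 * f 0 3 * f 0 4 * f 0 5 * f 0 6) * (f 1 2 * f 1 3 * f 1 4 * f 1 5 * f 1 6) *
    (f 2 3 * f 2 4 * f 2 5 * f 2 6) * (f 3 4 * f 3 5 * f 3 6) * (f 4 5 * f 4 6) * f 5 6 := by
  have h0 : Finset.Ioi (0 : Fin 7) = {1,2,3,4,5,6} := by decide
  have h1 : Finset.Ioi (1 : Fin 7) = {2,3,4,5,6} := by decide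
  have h2 : Finset.Ioi (2 : Fin 7) = {3,4,5,6} := by decide
  have h3 : Finset.Ioi (3 : Fin 7) = {4,5,6} := by decide
  have h4 : Finset.Ioi (4 : Fin 7) = {5,6} := by decide
  have h5 : Finset.Ioi (5 : Fin 7) = {6} := by decide
  have h6 : Finset.Ioi (6 : Fin 7) = ∅ := by decide
  rw [Fin.prod_univ_seven, h0, h1, h2, h3, h4, h5, h6]
  repeat rw [Finset.prod_insert (by decide)]
  simp only [Finset.prod_singleton, Finset.prod_empty, mul_one]
  simp only [mul_assoc]

lemma pairs_sum {M : Type*} [AddCommMonoid M] (f : Fin 7 → Fin 7 → M) :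
    ∑ i, ∑ j ∈ Finset.Ioi i, f i j =
    (f 0 1 + f 0 2 + f 0 3 + f 0 4 + f 0 5 + f 0 6) + (f 1 2 + f 1 3 + f 1 4 + f 1 5 + f 1 6) +
    (f 2 3 + f 2 4 + f 2 5 + f 2 6) + (f 3 4 + f 3 5 + f 3 6) + (f 4 5 + f 4 6) + f 5 6 :=
  pairs_prod (M := Multiplicative M) f

lemma pairs_sym (f : Fin 7 → Fin 7 → ℝ) (hs : ∀ i j, f i j = f j i) (h0 : ∀ i, f i i = 0) :
    ∑ i, ∑ j, f i j = 2 * ∑ i, ∑ j ∈ Finset.Ioi i, f i j := by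
  rw [pairs_sum]
  simp only [Fin.sum_univ_seven, h0]
  rw [hs 1 0, hs 2 0, hs 3 0, hs 4 0, hs 5 0, hs 6 0, hs 2 1, hs 3 1, hs 4 1, hs 5 1, hs 6 1,
    hs 3 2, hs 4 2, hs 5 2, hs 6 2, hs 4 3, hs 5 3, hs 6 3, hs 5 4, hs 6 4, hs 6 5]
  ring

lemma N_bound (a : Fin 7 → ℝ) :
    (∑ i, ∑ j ∈ Finset.Ioi i, |a i - a j|) ^ 2 ≤ 112 * ∑ i, a i ^ 2 := by
  set σ := Tuple.sort a with hσ
  have hmono : Monotone (a ∘ σ) := Tuple.monotone_sort a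
  have hQ : ∑ i, a i ^ 2 = ∑ i, (a (σ i)) ^ 2 := (Equiv.sum_comp σ (fun i => a i ^ 2)).symm
  have hN : ∑ i, ∑ j ∈ Finset.Ioi i, |a i - a j| = ∑ i, ∑ j ∈ Finset.Ioi i, |a (σ i) - a (σ j)| := by
    have h1 := pairs_sym (fun i j => |a i - a j|) (fun i j => abs_sub_comm _ _) (by simp)
    have h2 := pairs_sym (fun i j => |a (σ i) - a (σ j)|) (fun i j => abs_sub_comm _ _) (by simp)
    have h3 : ∑ i, ∑ j, |a i - a j| = ∑ i, ∑ j, |a (σ i) - a (σ j)| := by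
      rw [← Equiv.sum_comp σ]
      refine Finset.sum_congr rfl fun i _ => ?_
      rw [← Equiv.sum_comp σ]
    linarith
  rw [hN, hQ]
  have hN2 : ∑ i, ∑ j ∈ Finset.Ioi i, |a (σ i) - a (σ j)| =
      ∑ i, ∑ j ∈ Finset.Ioi i, (a (σ j) - a (σ i)) := by
    refine Finset.sum_congr rfl fun i _ => Finset.sum_congr rfl fun j hj => ?_
    have : a (σ i) ≤ a (σ j) := hmono (Finset.mem_Ioi.1 hj).le
    rw [abs_sub_comm, abs_of_nonneg (by linarith)]
  have hN3 : ∑ i, ∑ j ∈ Finset.Ioi i, (a (σ j) - a (σ i)) =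
      ∑ i : Fin 7, (2 * (i : ℝ) - 6) * a (σ i) := by
    rw [pairs_sum, Fin.sum_univ_seven]
    simp only [show ((0 : Fin 7) : ℕ) = 0 from rfl, show ((1 : Fin 7) : ℕ) = 1 from rfl,
      show ((2 : Fin 7) : ℕ) = 2 from rfl, show ((3 : Fin 7) : ℕ) = 3 from rfl,
      show ((4 : Fin 7) : ℕ) = 4 from rfl, show ((5 : Fin 7) : ℕ) = 5 from rfl,
      show ((6 : Fin 7) : ℕ) = 6 from rfl]
    push_cast
    ring
  rw [hN2, hN3]
  refine (Finset.sum_mul_sq_le_sq_mul_sq _ _ _).trans (le_of_eq ?_)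
  congr 1
  rw [Fin.sum_univ_seven]
  simp only [show ((0 : Fin 7) : ℕ) = 0 from rfl, show ((1 : Fin 7) : ℕ) = 1 from rfl,
      show ((2 : Fin 7) : ℕ) = 2 from rfl, show ((3 : Fin 7) : ℕ) = 3 from rfl,
      show ((4 : Fin 7) : ℕ) = 4 from rfl, show ((5 : Fin 7) : ℕ) = 5 from rfl,
      show ((6 : Fin 7) : ℕ) = 6 from rfl]
  norm_num

/-- normalized distance -/
noncomputable def rho (x y : ℂ) : ℝ := ‖y - x‖ / max ‖x‖ ‖y‖

lemma rho_real (x y : ℝ) {r : ℝ} (hr : 0 < r) : rho x y = rr (x / r) (y / r) := by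
  unfold rho rr
  rw [← Complex.ofReal_sub, Complex.norm_real, Complex.norm_real, Complex.norm_real,
    Real.norm_eq_abs, Real.norm_eq_abs, Real.norm_eq_abs, ← sub_div, abs_div, abs_div, abs_div,
    abs_of_pos hr, max_div_div_right hr.le, div_div_div_cancel_right₀ hr.ne', abs_sub_comm]

lemma rho_fc (x : ℝ) (z : ℂ) (hz : z ≠ 0) :
    rho x z * rho x (starRingEnd ℂ z) = fc (z.re / ‖z‖) (x / ‖z‖) := by
  have hr : 0 < ‖z‖ := norm_pos_iff.2 hz
  have h1 : ‖starRingEnd ℂ z - x‖ = ‖z - x‖ := by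
    rw [← Complex.norm_conj (z - x), map_sub, Complex.conj_ofReal]
  have h2 : ‖z - x‖ ^ 2 = ‖z‖ ^ 2 - 2 * z.re * x + x ^ 2 := by
    rw [← Complex.normSq_eq_norm_sq, ← Complex.normSq_eq_norm_sq, Complex.normSq_apply,
      Complex.normSq_apply]
    simp; ring
  have h3 : max |x / ‖z‖| 1 = max |x| ‖z‖ / ‖z‖ := by
    rw [abs_div, abs_of_pos hr, ← div_self hr.ne', max_div_div_right hr.le]
  unfold rho fc
  rw [Complex.norm_conj, h1, h3, Complex.norm_real, Real.norm_eq_abs, ← sq, div_pow, h2]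
  have : 0 < max |x| ‖z‖ := lt_max_of_lt_right hr
  field_simp
  ring

lemma rho_conj (z : ℂ) : rho z (starRingEnd ℂ z) = 2 * (|z.im| / ‖z‖) := by
  unfold rho
  have : ‖starRingEnd ℂ z - z‖ = 2 * |z.im| := by
    have : starRingEnd ℂ z - z = ((-(2 * z.im) : ℝ) : ℂ) * Complex.I := by
      apply Complex.ext <;> simp
      ring
    rw [this, norm_mul, Complex.norm_real, Complex.norm_I]
    simp
  rw [this, Complex.norm_conj, max_self, mul_div_assoc]

lemma rho_prod (g : Fin 7 → ℂ) (x : Fin 5 → ℝ) (z : ℂ)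
    (hg0 : g 0 = x 0) (hg1 : g 1 = x 1) (hg2 : g 2 = x 2) (hg3 : g 3 = x 3) (hg4 : g 4 = x 4)
    (hg5 : g 5 = z) (hg6 : g 6 = starRingEnd ℂ z) (hx : ∀ i, x i ≠ 0) (hz : z ≠ 0) :
    ∏ i, ∏ j ∈ Finset.Ioi i, rho (g i) (g j) ≤ 280 := by
  have hr : 0 < ‖z‖ := norm_pos_iff.2 hz
  have hcs : (|z.im| / ‖z‖) ^ 2 = 1 - (z.re / ‖z‖) ^ 2 := by
    have : ‖z‖ ^ 2 = z.re ^ 2 + z.im ^ 2 := by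
      rw [← Complex.normSq_eq_norm_sq, Complex.normSq_apply]; ring
    rw [div_pow, div_pow, sq_abs]; field_simp; linarith
  have := P_bound (x := fun i => x i / ‖z‖) (s := |z.im| / ‖z‖) (c := z.re / ‖z‖) (by positivity) hcs
    (fun i => div_ne_zero (hx i) hr.ne')
  refine le_trans (le_of_eq ?_) this
  rw [pairs_prod, hg0, hg1, hg2, hg3, hg4, hg5, hg6, Fin.prod_univ_five]
  simp only [← rho_fc _ _ hz, ← rho_conj, R5, ← rho_real _ _ hr]
  ring

lemma disc_bound (g : Fin 7 → ℂ) (x : Fin 5 → ℝ) (z : ℂ)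
    (hg0 : g 0 = x 0) (hg1 : g 1 = x 1) (hg2 : g 2 = x 2) (hg3 : g 3 = x 3) (hg4 : g 4 = x 4)
    (hg5 : g 5 = z) (hg6 : g 6 = starRingEnd ℂ z) (hne : ∀ i, g i ≠ 0)
    (hinj : Function.Injective g) (hsum : ∑ i, Real.log ‖g i‖ = 0) :
    Real.log ‖∏ i, ∏ j ∈ Finset.Ioi i, (g j - g i) ^ 2‖ ≤
      √(112 * ∑ i, (Real.log ‖g i‖) ^ 2) + 2 * Real.log 280 := by
  have hx : ∀ i, x i ≠ 0 := by
    intro i h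
    have h0 := hne 0; have h1 := hne 1; have h2 := hne 2; have h3 := hne 3; have h4 := hne 4
    fin_cases i <;> simp_all
  have hz : z ≠ 0 := by rw [← hg5]; exact hne 5
  have hmax : ∀ i j, 0 < max ‖g i‖ ‖g j‖ := fun i j => lt_max_of_lt_left (norm_pos_iff.2 (hne i))
  have hpos : ∀ i, ∀ j ∈ Finset.Ioi i, 0 < rho (g i) (g j) := by
    intro i j hj
    have : g j ≠ g i := fun h => (Finset.mem_Ioi.1 hj).ne' (hinj h)
    exact div_pos (norm_pos_iff.2 (sub_ne_zero.2 this)) (hmax i j)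
  have e1 : ∀ i, ∀ j ∈ Finset.Ioi i, ‖(g j - g i) ^ 2‖ = rho (g i) (g j) ^ 2 * max ‖g i‖ ‖g j‖ ^ 2 := by
    intro i j hj
    rw [norm_pow, ← mul_pow, rho, div_mul_cancel₀ _ (hmax i j).ne']
  have e2 : ‖∏ i, ∏ j ∈ Finset.Ioi i, (g j - g i) ^ 2‖ =
      (∏ i, ∏ j ∈ Finset.Ioi i, rho (g i) (g j)) ^ 2 * ∏ i, ∏ j ∈ Finset.Ioi i, max ‖g i‖ ‖g j‖ ^ 2 := by
    rw [norm_prod, ← Finset.prod_pow, ← Finset.prod_mul_distrib]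
    refine Finset.prod_congr rfl fun i _ => ?_
    rw [norm_prod, ← Finset.prod_pow, ← Finset.prod_mul_distrib]
    exact Finset.prod_congr rfl fun j hj => e1 i j hj
  have hPpos : 0 < ∏ i, ∏ j ∈ Finset.Ioi i, rho (g i) (g j) :=
    Finset.prod_pos fun i _ => Finset.prod_pos fun j hj => hpos i j hj
  have hMpos : 0 < ∏ i, ∏ j ∈ Finset.Ioi i, max ‖g i‖ ‖g j‖ ^ 2 :=
    Finset.prod_pos fun i _ => Finset.prod_pos fun j _ => pow_pos (hmax i j) 2
  rw [e2, Real.log_mul (pow_pos hPpos 2).ne' hMpos.ne', Real.log_pow, add_comm]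
  have hP := Real.log_le_log hPpos (rho_prod g x z hg0 hg1 hg2 hg3 hg4 hg5 hg6 hx hz)
  have hM : Real.log (∏ i, ∏ j ∈ Finset.Ioi i, max ‖g i‖ ‖g j‖ ^ 2) =
      ∑ i, ∑ j ∈ Finset.Ioi i, |Real.log ‖g i‖ - Real.log ‖g j‖| := by
    rw [Real.log_prod (fun i _ => (Finset.prod_pos fun j _ => pow_pos (hmax i j) 2).ne')]
    have : ∀ i, Real.log (∏ j ∈ Finset.Ioi i, max ‖g i‖ ‖g j‖ ^ 2) = ∑ j ∈ Finset.Ioi i,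
        ((Real.log ‖g i‖ + Real.log ‖g j‖) + |Real.log ‖g i‖ - Real.log ‖g j‖|) := by
      intro i
      rw [Real.log_prod (fun j _ => (pow_pos (hmax i j) 2).ne')]
      refine Finset.sum_congr rfl fun j _ => ?_
      rw [Real.log_pow]
      have hi := norm_pos_iff.2 (hne i)
      have hj := norm_pos_iff.2 (hne j)
      rcases le_total ‖g i‖ ‖g j‖ with h | h
      · have := Real.log_le_log hi h
        rw [max_eq_right h, abs_of_nonpos (by linarith)]; push_cast; ring
      · have := Real.log_le_log hj h
        rw [max_eq_left h, abs_of_nonneg (by linarith)]; push_cast; ring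
    simp only [this, Finset.sum_add_distrib]
    rw [← Finset.sum_add_distrib]
    simp only [← Finset.sum_add_distrib]
    have h6 : ∑ i, ∑ j ∈ Finset.Ioi i, (Real.log ‖g i‖ + Real.log ‖g j‖) = 6 * ∑ i, Real.log ‖g i‖ := by
      rw [pairs_sum, Fin.sum_univ_seven]; ring
    simp only [Finset.sum_add_distrib] at h6 ⊢
    linarith
  rw [hM]
  have hN := Real.le_sqrt_of_sq_le (N_bound fun i => Real.log ‖g i‖)
  push_cast
  linarith

open NumberField

section
open Module

lemma discr_le_of_integral (K : Type*) [Field K] [NumberField K] {n : ℕ} (hn : finrank ℚ K = n)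
    (y : Fin n → 𝓞 K) (h : Algebra.discr ℚ (fun i => (y i : K)) ≠ 0) :
    |(NumberField.discr K : ℝ)| ≤ |((Algebra.discr ℚ (fun i => (y i : K)) : ℚ) : ℝ)| := by
  classical
  have hcard : Fintype.card (Module.Free.ChooseBasisIndex ℤ (𝓞 K)) = n := by
    rw [← finrank_eq_card_chooseBasisIndex, RingOfIntegers.rank, hn]
  let f := Fintype.equivFinOfCardEq hcard
  let b := (RingOfIntegers.basis K).reindex f
  let P : Matrix (Fin n) (Fin n) ℤ := b.toMatrix y
  let bQ := (integralBasis K).reindex f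
  have hb : ∀ i, bQ i = (b i : K) := by
    intro i
    simp [bQ, b, integralBasis_apply]
  have hD : Algebra.discr ℚ bQ = (NumberField.discr K : ℚ) := by
    rw [coe_discr, ← Algebra.discr_reindex ℚ (integralBasis K) f]
    congr 1
    ext i
    simp [bQ]
  have hy : (fun i => (y i : K)) =
      Matrix.vecMul (bQ : Fin n → K) ((P.map (Int.castRingHom ℚ)).map (algebraMap ℚ K)) := by
    ext i
    have := b.sum_toMatrix_smul_self y i
    conv_lhs => rw [← this]
    simp only [Matrix.vecMul, dotProduct, Matrix.map_apply, hb]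
    push_cast
    simp [P, mul_comm]
  have key := Algebra.discr_of_matrix_vecMul (bQ : Fin n → K) (P.map (Int.castRingHom ℚ))
  rw [← hy, hD] at key
  have hdet : (P.map (Int.castRingHom ℚ)).det = (P.det : ℚ) := by
    rw [← RingHom.mapMatrix_apply, ← RingHom.map_det]; simp
  rw [hdet] at key
  have hP : P.det ≠ 0 := by
    intro h0
    rw [h0] at key
    exact h (by rw [key]; simp)
  rw [key]
  rw [Rat.cast_mul, Rat.cast_pow, Rat.cast_intCast, Rat.cast_intCast]
  rw [abs_mul]
  have : (1 : ℝ) ≤ |(P.det : ℝ) ^ 2| := by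
    rw [abs_pow]
    have : (1 : ℝ) ≤ |(P.det : ℝ)| := by exact_mod_cast Int.one_le_abs hP
    nlinarith
  exact le_mul_of_one_le_left (abs_nonneg _) this

lemma discr_powers (K : Type*) [Field K] [NumberField K] {n : ℕ}
    (e : Fin n ≃ (K →ₐ[ℚ] ℂ)) (x : K) :
    ((Algebra.discr ℚ (fun i : Fin n => x ^ (i : ℕ)) : ℚ) : ℂ) =
      ∏ i : Fin n, ∏ j ∈ Finset.Ioi i, (e j x - e i x) ^ 2 := by
  have := Algebra.discr_eq_det_embeddingsMatrixReindex_pow_two ℚ ℂ (fun i : Fin n => x ^ (i : ℕ)) e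
  have h2 : Algebra.embeddingsMatrixReindex ℚ ℂ (fun i : Fin n => x ^ (i : ℕ)) e =
      (Matrix.vandermonde fun i => e i x).transpose := by
    ext i j
    simp [Algebra.embeddingsMatrixReindex, Algebra.embeddingsMatrix]
  rw [h2, Matrix.det_transpose, Matrix.det_vandermonde, ← Finset.prod_pow] at this
  simp only [← Finset.prod_pow] at this
  rw [← this]; simp

lemma adjoin_top (K : Type*) [Field K] [NumberField K] (hp : (finrank ℚ K).Prime) (x : K)
    (hx : ∀ q : ℚ, x ≠ algebraMap ℚ K q) (φ ψ : K →ₐ[ℚ] ℂ) (h : φ x = ψ x) : φ = ψ := by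
  have := Subalgebra.isSimpleOrder_of_finrank_prime ℚ K hp
  have ht : Algebra.adjoin ℚ {x} = ⊤ := by
    refine (eq_bot_or_eq_top _).resolve_left ?_
    intro hb
    have hm := Algebra.self_mem_adjoin_singleton ℚ x
    rw [hb, Algebra.mem_bot] at hm
    obtain ⟨q, hq⟩ := hm
    exact hx q hq.symm
  refine AlgHom.ext_of_adjoin_eq_top ht ?_
  rintro y rfl
  exact h

end

section
open Module Matrix

noncomputable def Mmat : Matrix (Fin 5) (Fin 5) ℝ :=
  1 + Matrix.replicateCol Unit (fun _ => (1 / 2 : ℝ)) * Matrix.replicateRow Unit (fun _ => (1 : ℝ))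

lemma Mmat_det : Mmat.det = 7 / 2 := by
  rw [Mmat, Matrix.det_one_add_replicateCol_mul_replicateRow]
  simp [dotProduct]; norm_num

lemma Mmat_apply (i j : Fin 5) : Mmat i j = (if i = j then 1 else 0) + 1 / 2 := by
  simp [Mmat, Matrix.mul_apply, Matrix.one_apply]

lemma Mmat_qf (y : Fin 5 → ℝ) : qf Mmat y = ∑ j, y j ^ 2 + 1 / 2 * (∑ j, y j) ^ 2 := by
  rw [qf_sum]
  simp only [Mmat_apply, Fin.sum_univ_five]
  simp [Fin.ext_iff]
  ring

lemma Mmat_PD : PD Mmat := by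
  constructor
  · ext i j
    simp [Mmat_apply, eq_comm]
  · intro x hx
    rw [Mmat_qf]
    obtain ⟨i, hi⟩ := Function.ne_iff.1 hx
    have : 0 < ∑ j, x j ^ 2 :=
      Finset.sum_pos' (fun j _ => sq_nonneg _) ⟨i, Finset.mem_univ _, by
        have : x i ≠ 0 := hi
        positivity⟩
    positivity

lemma unit_exists (K : Type*) [Field K] [NumberField K] (ρ : Fin 5 ≃ {w : InfinitePlace K // w.IsReal})
    (w' : InfinitePlace K) (hw : ∀ w : InfinitePlace K, w ≠ w' ↔ w.IsReal) (hr : Units.rank K = 5) :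
    ∃ u : (𝓞 K)ˣ,
      0 < ∑ j, Real.log ((ρ j).1 (u : K)) ^ 2 + 1 / 2 * (∑ j, Real.log ((ρ j).1 (u : K))) ^ 2 ∧
      (∑ j, Real.log ((ρ j).1 (u : K)) ^ 2 + 1 / 2 * (∑ j, Real.log ((ρ j).1 (u : K))) ^ 2) ^ 5 ≤
        1.334 ^ 10 * (Units.regulator K ^ 2 * (7 / 2)) := by
  classical
  let f : {w : InfinitePlace K // w ≠ w'} ≃ Fin 5 := (Equiv.subtypeEquivRight hw).trans ρ.symm
  let e := f.trans (finCongr hr.symm)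
  have hreg := Units.regulator_eq_det K w' e
  let ε : Fin 5 → (𝓞 K)ˣ := fun i => Units.fundSystem K (finCongr hr.symm i)
  let A : Matrix (Fin 5) (Fin 5) ℝ := Matrix.of fun i j => Real.log ((ρ j).1 (ε i : K))
  have hA : Units.regulator K = |A.det| := by
    rw [hreg, ← Matrix.det_submatrix_equiv_self f]
    congr 2
    ext i j
    have h1 : (j : InfinitePlace K).mult = 1 := InfinitePlace.mult_isReal ⟨j.1, (hw _).1 j.2⟩
    simp [A, f, e, ε, h1]
  have hdet0 : A.det ≠ 0 := by
    intro h
    have := Units.regulator_pos K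
    rw [hA, h] at this
    simp at this
  have hPD := conj_PD (M := Aᵀ) Mmat_PD (by rw [Matrix.det_transpose]; exact hdet0.isUnit)
  obtain ⟨-, U, hU, hq⟩ := hermite (τ := 1.334) (by norm_num) 4 _ hPD
  have hv0 : (fun i => (U i 0 : ℝ)) ≠ 0 := by
    intro h
    have : ∀ i, U i 0 = 0 := fun i => by
      have := congrFun h i
      simpa using this
    rw [Matrix.det_eq_zero_of_column_eq_zero 0 this] at hU
    simp at hU
  have hpos := hPD.2 _ hv0
  have hGdet : (Aᵀᵀ * Mmat * Aᵀ).det = Units.regulator K ^ 2 * (7 / 2) := by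
    rw [hA, sq_abs]
    simp only [Matrix.det_mul, Matrix.det_transpose, Mmat_det]
    ring
  rw [hGdet] at hq
  rw [qf_conj, Mmat_qf] at hq hpos
  have hlog : ∀ j, (Aᵀ *ᵥ fun i => (U i 0 : ℝ)) j =
      Real.log ((ρ j).1 ((∏ i, ε i ^ (U i 0) : (𝓞 K)ˣ) : K)) := by
    intro j
    have : ((ρ j).1 ((∏ i, ε i ^ (U i 0) : (𝓞 K)ˣ) : K)) = ∏ i, ((ρ j).1 (ε i : K)) ^ (U i 0) := by
      simp [Units.coe_zpow, map_prod, map_zpow₀]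
    rw [this, Real.log_prod (fun i _ => zpow_ne_zero _ (by simp))]
    simp [Matrix.mulVec, dotProduct, A, Real.log_zpow, mul_comm]
  simp only [hlog] at hq hpos
  exact ⟨_, hpos, hq⟩

end

lemma final_num {Q : ℝ} (hQ0 : 0 < Q) {R : ℝ} (hR0 : 0 < R) (hR : R ≤ 3.2)
    (h : Q ^ 5 ≤ 1.334 ^ 10 * (R ^ 2 * (7 / 2))) :
    √(112 * Q) + 2 * Real.log 280 < 31.492 := by
  have hQ : Q ≤ 3.641 := by
    by_contra! hlt
    have h1 : (3.641 : ℝ) ^ 5 ≤ Q ^ 5 := pow_le_pow_left₀ (by norm_num) hlt.le 5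
    have h2 : R ^ 2 ≤ 3.2 ^ 2 := pow_le_pow_left₀ hR0.le hR 2
    norm_num at h1 h2 h
    linarith
  have hs : √(112 * Q) ≤ 20.2 := by
    apply Real.sqrt_le_iff.2
    constructor
    · norm_num
    · norm_num at hQ ⊢; linarith
  have hl : Real.log 280 < 5.64 := by
    rw [Real.log_lt_iff_lt_exp (by norm_num)]
    have h1 : (280 : ℝ) ^ 25 < Real.exp 5.64 ^ 25 := by
      rw [← Real.exp_nat_mul]
      have : ((25 : ℕ) : ℝ) * 5.64 = ((141 : ℕ) : ℝ) * 1 := by norm_num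
      rw [this, Real.exp_nat_mul]
      refine lt_trans ?_ (pow_lt_pow_left₀ Real.exp_one_gt_d9 (by norm_num) (by norm_num))
      norm_num
    exact lt_of_pow_lt_pow_left₀ 25 (Real.exp_pos _).le h1
  norm_num at hs hl ⊢
  linarith

theorem log_discr_lt_of_regulator_le
    (K : Type*) [Field K] [NumberField K]
    (hdeg : Module.finrank ℚ K = 7)
    (hreal : InfinitePlace.nrRealPlaces K = 5)
    (hreg : NumberField.Units.regulator K ≤ 3.2) :
    Real.log |(NumberField.discr K : ℝ)| < 31.492 := by
  classical
  have hc : InfinitePlace.nrComplexPlaces K = 1 := by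
    have := InfinitePlace.card_add_two_mul_card_eq_rank K
    omega
  have hcard := InfinitePlace.card_eq_nrRealPlaces_add_nrComplexPlaces K
  have hrank : Units.rank K = 5 := by
    unfold Units.rank
    omega
  let ρ : Fin 5 ≃ {w : InfinitePlace K // w.IsReal} := (Fintype.equivFinOfCardEq hreal).symm
  obtain ⟨⟨w', hw'⟩, huniq⟩ := Fintype.card_eq_one_iff.1 hc
  have hw : ∀ w : InfinitePlace K, w ≠ w' ↔ w.IsReal := by
    intro w
    constructor
    · intro h
      refine (InfinitePlace.isReal_or_isComplex w).resolve_right fun hcx => h ?_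
      exact congrArg Subtype.val (huniq ⟨w, hcx⟩)
    · rintro h rfl
      exact (InfinitePlace.not_isReal_iff_isComplex.2 hw') h
  obtain ⟨u, hQ0, hQ⟩ := unit_exists K ρ w' hw hrank
  set φ := w'.embedding with hφ
  let em : Fin 7 → (K →+* ℂ) := ![(ρ 0).1.embedding, (ρ 1).1.embedding, (ρ 2).1.embedding,
    (ρ 3).1.embedding, (ρ 4).1.embedding, φ, ComplexEmbedding.conjugate φ]
  have hpl : ∀ i, InfinitePlace.mk (em i) = (![(ρ 0).1, (ρ 1).1, (ρ 2).1, (ρ 3).1, (ρ 4).1, w', w'] :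
      Fin 7 → InfinitePlace K) i := by
    intro i
    fin_cases i <;> simp [em, hφ, InfinitePlace.mk_embedding, InfinitePlace.mk_conjugate_eq]
  have hρw : ∀ i, (ρ i).1 ≠ w' := fun i => (hw _).2 (ρ i).2
  have hρρ : ∀ i j, (ρ i).1 = (ρ j).1 ↔ i = j := fun i j => by
    rw [← Subtype.ext_iff, ρ.injective.eq_iff]
  have hcc : ComplexEmbedding.conjugate φ ≠ φ := by
    intro h
    exact (InfinitePlace.isComplex_iff.1 hw') (ComplexEmbedding.isReal_iff.2 h)
  have heminj : Function.Injective em := by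
    intro i j h
    have h2 := congrArg InfinitePlace.mk h
    rw [hpl, hpl] at h2
    fin_cases i <;> fin_cases j <;> simp [hρρ, hρw, (hρw _).symm] at h2 ⊢
    · exact hcc h.symm
    · exact hcc h
  have hembij : Function.Bijective em := by
    rw [Fintype.bijective_iff_injective_and_card]
    refine ⟨heminj, ?_⟩
    rw [Embeddings.card, hdeg, Fintype.card_fin]
  let e : Fin 7 ≃ (K →ₐ[ℚ] ℂ) := (Equiv.ofBijective em hembij).trans (RingHom.equivRatAlgHom K ℂ)
  have he : ∀ i x, e i x = em i x := fun i x => rfl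
  let x : K := (u : K)
  have hx0 : x ≠ 0 := by simp [x]
  have hem0 : ∀ i, em i x ≠ 0 := fun i => by simpa using hx0
  have hnorm : ∀ i, ‖em i x‖ = (![(ρ 0).1, (ρ 1).1, (ρ 2).1, (ρ 3).1, (ρ 4).1, w', w'] :
      Fin 7 → InfinitePlace K) i x := by
    intro i
    rw [← hpl i, InfinitePlace.apply]
  have hlogw : 2 * Real.log (w' x) = - ∑ j, Real.log ((ρ j).1 x) := by
    have h := Units.sum_mult_mul_log u
    rw [← Finset.sum_erase_add _ _ (Finset.mem_univ w')] at h
    have h2 : ∑ w ∈ Finset.univ.erase w', (w.mult : ℝ) * Real.log (w (u : K)) =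
        ∑ j, Real.log ((ρ j).1 x) := by
      symm
      refine Finset.sum_bij (fun j _ => (ρ j).1) ?_ ?_ ?_ ?_
      · intro j _; simp [hρw]
      · intro i _ j _ h; exact (hρρ i j).1 h
      · intro w hw2
        have hwr : w.IsReal := (hw w).1 (Finset.ne_of_mem_erase hw2)
        exact ⟨ρ.symm ⟨w, hwr⟩, Finset.mem_univ _, by simp⟩
      · intro j _
        rw [InfinitePlace.mult_isReal]; simp [x]
    have hm : w'.mult = 2 := by
      rw [InfinitePlace.mult, if_neg (InfinitePlace.not_isReal_iff_isComplex.2 hw')]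
    rw [h2, hm] at h
    push_cast at h
    linarith
  have hsum0 : ∑ i, Real.log ‖em i x‖ = 0 := by
    simp only [hnorm]
    rw [Fin.sum_univ_seven]
    rw [Fin.sum_univ_five] at hlogw
    simp
    linarith
  have hsumQ : ∑ i, Real.log ‖em i x‖ ^ 2 = ∑ j, Real.log ((ρ j).1 (u : K)) ^ 2 +
      1 / 2 * (∑ j, Real.log ((ρ j).1 (u : K))) ^ 2 := by
    have h3 : (∑ j, Real.log ((ρ j).1 (u : K))) ^ 2 = 4 * Real.log (w' x) ^ 2 := by
      have : ∑ j, Real.log ((ρ j).1 (u : K)) = - (2 * Real.log (w' x)) := by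
        rw [hlogw]; simp [x]
      rw [this]; ring
    rw [h3]
    simp only [hnorm]
    rw [Fin.sum_univ_seven, Fin.sum_univ_five]
    simp [x]
    ring
  have hxq : ∀ q : ℚ, x ≠ algebraMap ℚ K q := by
    intro q hq
    have h4 : ∀ i, Real.log ‖em i x‖ = Real.log ‖(q : ℂ)‖ := by
      intro i; rw [hq]; simp
    rw [← hsumQ] at hQ0
    simp only [h4] at hsum0 hQ0
    rw [Finset.sum_const] at hsum0
    have h5 : Real.log ‖(q : ℂ)‖ = 0 := by simpa using hsum0
    rw [h5] at hQ0
    simp at hQ0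
  have hinj : Function.Injective (fun i => em i x) := by
    intro i j h
    exact e.injective (adjoin_top K (by rw [hdeg]; norm_num) x hxq (e i) (e j) h)
  have hdisc := discr_powers K e x
  have hy : (fun i : Fin 7 => x ^ (i : ℕ)) = fun i : Fin 7 => (((u : 𝓞 K) ^ (i : ℕ) : 𝓞 K) : K) := by
    ext i; simp [x]
  have hne : Algebra.discr ℚ (fun i : Fin 7 => x ^ (i : ℕ)) ≠ 0 := by
    intro h0
    rw [h0, Rat.cast_zero, eq_comm, Finset.prod_eq_zero_iff] at hdisc
    obtain ⟨i, _, hi⟩ := hdisc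
    rw [Finset.prod_eq_zero_iff] at hi
    obtain ⟨j, hj, hij⟩ := hi
    have : e j x = e i x := sub_eq_zero.1 (pow_eq_zero_iff (by norm_num) |>.1 hij)
    exact (Finset.mem_Ioi.1 hj).ne' (hinj this)
  have hle := discr_le_of_integral K hdeg (fun i : Fin 7 => (u : 𝓞 K) ^ (i : ℕ)) (by rw [← hy]; exact hne)
  rw [← hy] at hle
  have hnd : |((Algebra.discr ℚ (fun i : Fin 7 => x ^ (i : ℕ)) : ℚ) : ℝ)| =
      ‖∏ i, ∏ j ∈ Finset.Ioi i, (em j x - em i x) ^ 2‖ := by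
    have : ‖((Algebra.discr ℚ (fun i : Fin 7 => x ^ (i : ℕ)) : ℚ) : ℂ)‖ =
        |((Algebra.discr ℚ (fun i : Fin 7 => x ^ (i : ℕ)) : ℚ) : ℝ)| := by
      rw [← Complex.ofReal_ratCast, Complex.norm_real, Real.norm_eq_abs]
    rw [← this, hdisc]
    rfl
  rw [hnd] at hle
  have hD0 : 0 < |(NumberField.discr K : ℝ)| := abs_pos.2 (by exact_mod_cast NumberField.discr_ne_zero K)
  have hlog := Real.log_le_log hD0 hle
  have hb := disc_bound (fun i => em i x)
    (fun j => InfinitePlace.embedding_of_isReal (ρ j).2 x) (φ x)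
    (InfinitePlace.embedding_of_isReal_apply (ρ 0).2 x).symm
    (InfinitePlace.embedding_of_isReal_apply (ρ 1).2 x).symm
    (InfinitePlace.embedding_of_isReal_apply (ρ 2).2 x).symm
    (InfinitePlace.embedding_of_isReal_apply (ρ 3).2 x).symm
    (InfinitePlace.embedding_of_isReal_apply (ρ 4).2 x).symm
    rfl rfl hem0 hinj hsum0
  rw [hsumQ] at hb
  have hfin := final_num hQ0 (Units.regulator_pos K) hreg hQ
  exact (hlog.trans hb).trans_lt hfin
end
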